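/- Let u be a viscosity solution of λ (det D²u)^p ≤ u_t ≤ Λ (det D²u)^p in Ω × [−T,0] such that u(·,0) ≥ 0 on Ω. Suppose the convex set D := {x ∈ Ω : u(x,0) = 0} contains a line segment of positive length and has an extremal point lying in Ω. Then u(x,−T) = 0 for all x ∈ D. -/

import Mathlib

open Set Metric MeasureTheory
open scoped RealInnerProductSpace

noncomputable section

abbrev E (n : ℕ) := EuclideanSpace ℝ (Fin n)

variable {n : ℕ}

/-- The time derivative `∂ₜφ(x,t)`. -/
noncomputable def timeDeriv (φ : E n → ℝ → ℝ) (x : E n) (t : ℝ) : ℝ :=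
  deriv (φ x) t

/-- The spatial Hessian matrix `D²φ(x,t)` (in the standard coordinates). -/
noncomputable def hessMatrix (φ : E n → ℝ → ℝ) (x : E n) (t : ℝ) :
    Matrix (Fin n) (Fin n) ℝ :=
  Matrix.of fun i j =>
    fderiv ℝ (fun y => fderiv ℝ (fun z => φ z t) y (EuclideanSpace.single j (1:ℝ))) x
      (EuclideanSpace.single i (1:ℝ))

/-- `φ` is an admissible test function near `(x₀,t₀)`: C² in `x` and C¹ in `t` nearby. -/
def IsTestAt (φ : E n → ℝ → ℝ) (x₀ : E n) (t₀ : ℝ) : Prop :=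
  ∃ ε > (0:ℝ),
    (∀ t ∈ ball t₀ ε, ContDiffOn ℝ 2 (fun x => φ x t) (ball x₀ ε)) ∧
    (∀ x ∈ ball x₀ ε, ContDiffOn ℝ 1 (fun t => φ x t) (ball t₀ ε))

/-- `u - φ` attains a local maximum at `(x₀,t₀)` among times `t ≤ t₀`,
relative to `closure Ω × [t₁,t₂]`. -/
def LocalMaxBelow (Ω : Set (E n)) (t₁ t₂ : ℝ) (u φ : E n → ℝ → ℝ)
    (x₀ : E n) (t₀ : ℝ) : Prop :=
  ∃ ε > (0:ℝ), ∀ x ∈ closure Ω, ∀ t ∈ Icc t₁ t₂, t ≤ t₀ →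
    dist x x₀ < ε → dist t t₀ < ε →
    u x t - φ x t ≤ u x₀ t₀ - φ x₀ t₀

/-- `u - φ` attains a local minimum at `(x₀,t₀)` among times `t ≤ t₀`. -/
def LocalMinBelow (Ω : Set (E n)) (t₁ t₂ : ℝ) (u φ : E n → ℝ → ℝ)
    (x₀ : E n) (t₀ : ℝ) : Prop :=
  ∃ ε > (0:ℝ), ∀ x ∈ closure Ω, ∀ t ∈ Icc t₁ t₂, t ≤ t₀ →
    dist x x₀ < ε → dist t t₀ < ε →
    u x₀ t₀ - φ x₀ t₀ ≤ u x t - φ x t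

/-- Viscosity subsolution of `u_t ≤ Λ (det D²u)^p` on `Ω × [t₁,t₂]`. -/
def ViscSubsolution (Lam p : ℝ) (Ω : Set (E n)) (t₁ t₂ : ℝ) (u : E n → ℝ → ℝ) : Prop :=
  ∀ x₀ ∈ Ω, ∀ t₀ ∈ Ioc t₁ t₂, ∀ φ : E n → ℝ → ℝ, IsTestAt φ x₀ t₀ →
    LocalMaxBelow Ω t₁ t₂ u φ x₀ t₀ →
    timeDeriv φ x₀ t₀ ≤ Lam * max (hessMatrix φ x₀ t₀).det 0 ^ p

/-- Viscosity supersolution of `u_t ≥ λ (det D²u)^p` on `Ω × [t₁,t₂]`. -/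
def ViscSupersolution (lam p : ℝ) (Ω : Set (E n)) (t₁ t₂ : ℝ) (u : E n → ℝ → ℝ) : Prop :=
  ∀ x₀ ∈ Ω, ∀ t₀ ∈ Ioc t₁ t₂, ∀ φ : E n → ℝ → ℝ, IsTestAt φ x₀ t₀ →
    LocalMinBelow Ω t₁ t₂ u φ x₀ t₀ →
    (hessMatrix φ x₀ t₀).PosSemidef →
    lam * (hessMatrix φ x₀ t₀).det ^ p ≤ timeDeriv φ x₀ t₀

/-- The regularity/structure assumptions: continuity on `closure Ω × [t₁,t₂]`,
convexity in `x`, monotonicity in `t`. -/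
structure ParabolicRegular (Ω : Set (E n)) (t₁ t₂ : ℝ) (u : E n → ℝ → ℝ) : Prop where
  cont : ContinuousOn (fun q : E n × ℝ => u q.1 q.2) (closure Ω ×ˢ Icc t₁ t₂)
  conv : ∀ t ∈ Icc t₁ t₂, ConvexOn ℝ (closure Ω) (fun x => u x t)
  mono : ∀ x ∈ closure Ω, ∀ s ∈ Icc t₁ t₂, ∀ t ∈ Icc t₁ t₂, s ≤ t → u x s ≤ u x t

/-- Viscosity solution of `λ (det D²u)^p ≤ u_t ≤ Λ (det D²u)^p` on `Ω × [t₁,t₂]`. -/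
def ViscositySolution (lam Lam p : ℝ) (Ω : Set (E n)) (t₁ t₂ : ℝ) (u : E n → ℝ → ℝ) : Prop :=
  ParabolicRegular Ω t₁ t₂ u ∧ ViscSubsolution Lam p Ω t₁ t₂ u ∧
    ViscSupersolution lam p Ω t₁ t₂ u

/-- `w` is `C^{1,α}` at `x₀` (relative to the set `D`) with some finite constant. -/
def C1AlphaAt (w : E n → ℝ) (D : Set (E n)) (α : ℝ) (x₀ : E n) : Prop :=
  ∃ C a : ℝ, ∃ q : E n, ∀ x ∈ D, |w x - (a + ⟪q, x - x₀⟫)| ≤ C * ‖x - x₀‖ ^ (1 + α)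

/-- `w` is `C^{1,α}` at `x₀` in the direction `e` (relative to the set `D`). -/
def C1AlphaDirAt (w : E n → ℝ) (D : Set (E n)) (α : ℝ) (x₀ e : E n) : Prop :=
  ∃ C a q : ℝ, ∀ s : ℝ, x₀ + s • e ∈ D →
    |w (x₀ + s • e) - (a + q * s)| ≤ C * |s| ^ (1 + α)

/-- A convex set `S` is `d`-balanced with respect to `x₀`. -/
def DBalanced (d : ℝ) (S : Set (E n)) (x₀ : E n) : Prop :=
  ∃ A : E n →ₗ[ℝ] E n, Function.Bijective A ∧
    ball (0 : E n) 1 ⊆ A '' ((fun y => y - x₀) '' S) ∧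
    A '' ((fun y => y - x₀) '' S) ⊆ ball (0 : E n) d

/-- `x₀` is an extremal point of the convex set `D`. -/
def ExtremalPoint (D : Set (E n)) (x₀ : E n) : Prop :=
  ¬ ∃ y ∈ closure D, ∃ z ∈ closure D, ∃ t : ℝ,
      0 < t ∧ t < 1 ∧ y ≠ z ∧ x₀ = t • y + (1 - t) • z

lemma isTestAt_quad {φ : E n → ℝ → ℝ} {B : E n →L[ℝ] E n} {α β c₁ c₂ c₃ : ℝ} {a e v v' : E n}
    (hφ : ∀ x t, φ x t = α * ‖B x - a‖ ^ 2 + β * (⟪e, x⟫ + c₁) ^ 2 + (⟪v, x⟫ + c₂)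
      + t * (⟪v', x⟫ + c₃)) (x₀ : E n) (t₀ : ℝ) : IsTestAt φ x₀ t₀ := by
  refine ⟨1, one_pos, fun t _ => ?_, fun x _ => ?_⟩
  · refine ContDiff.contDiffOn ?_
    simp only [hφ]
    have h1 : ContDiff ℝ 2 (fun x : E n => ‖B x - a‖ ^ 2) :=
      (B.contDiff.sub contDiff_const).norm_sq ℝ
    have h2 : ∀ e : E n, ContDiff ℝ 2 (fun x : E n => ⟪e, x⟫) := fun e => (innerSL ℝ e).contDiff
    exact (((contDiff_const.mul h1).add (contDiff_const.mul
      (((h2 e).add contDiff_const).pow 2))).add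
      ((h2 v).add contDiff_const)).add (contDiff_const.mul ((h2 v').add contDiff_const))
  · refine ContDiff.contDiffOn ?_
    have : (fun t => φ x t) = fun t => α * ‖B x - a‖ ^ 2 + β * (⟪e, x⟫ + c₁) ^ 2 + (⟪v, x⟫ + c₂)
      + t * (⟪v', x⟫ + c₃) := funext (hφ x)
    rw [this]; fun_prop

lemma timeDeriv_quad {φ : E n → ℝ → ℝ} {B : E n →L[ℝ] E n} {α β c₁ c₂ c₃ : ℝ} {a e v v' : E n}
    (hφ : ∀ x t, φ x t = α * ‖B x - a‖ ^ 2 + β * (⟪e, x⟫ + c₁) ^ 2 + (⟪v, x⟫ + c₂)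
      + t * (⟪v', x⟫ + c₃)) (x₀ : E n) (t₀ : ℝ) : timeDeriv φ x₀ t₀ = ⟪v', x₀⟫ + c₃ := by
  have : φ x₀ = fun t => α * ‖B x₀ - a‖ ^ 2 + β * (⟪e, x₀⟫ + c₁) ^ 2 + (⟪v, x₀⟫ + c₂)
      + t * (⟪v', x₀⟫ + c₃) := funext (hφ x₀)
  rw [timeDeriv, this]
  have h := ((hasDerivAt_id t₀).mul_const (⟪v', x₀⟫ + c₃)).const_add
    (α * ‖B x₀ - a‖ ^ 2 + β * (⟪e, x₀⟫ + c₁) ^ 2 + (⟪v, x₀⟫ + c₂))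
  exact h.deriv.trans (one_mul _)

lemma hessMatrix_quad {φ : E n → ℝ → ℝ} {B : E n →L[ℝ] E n} {α β c₁ c₂ c₃ : ℝ} {a e v v' : E n}
    (hφ : ∀ x t, φ x t = α * ‖B x - a‖ ^ 2 + β * (⟪e, x⟫ + c₁) ^ 2 + (⟪v, x⟫ + c₂)
      + t * (⟪v', x⟫ + c₃)) (x₀ : E n) (t₀ : ℝ) (i j : Fin n) :
    hessMatrix φ x₀ t₀ i j = 2 * α * ⟪B (EuclideanSpace.single i (1:ℝ)),
      B (EuclideanSpace.single j (1:ℝ))⟫ + 2 * β * (e i * e j) := by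
  have h1 : ∀ y w : E n, fderiv ℝ (fun z => φ z t₀) y w =
      2 * α * ⟪B y - a, B w⟫ + 2 * β * (⟪e, y⟫ + c₁) * ⟪e, w⟫ + ⟪v, w⟫ + t₀ * ⟪v', w⟫ := by
    intro y w
    have hB : HasFDerivAt (fun z => B z - a) B y := B.hasFDerivAt.sub_const a
    have hi : ∀ (e : E n), HasFDerivAt (fun z : E n => ⟪e, z⟫) (innerSL ℝ e) y :=
      fun e => (innerSL ℝ e).hasFDerivAt
    have h := ((hB.norm_sq.const_mul α).add
      ((((hi e).add_const c₁).pow 2).const_mul β)).add ((hi v).add_const c₂) |>.add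
      (((hi v').add_const c₃).const_mul t₀)
    have h' := (h.congr_of_eventuallyEq (f₁ := fun z => φ z t₀)
      (Filter.Eventually.of_forall fun z => by simp [hφ])).fderiv
    rw [h']
    simp [inner_sub_left]
    ring
  rw [hessMatrix, Matrix.of_apply]
  have h2 : (fun y => fderiv ℝ (fun z => φ z t₀) y (EuclideanSpace.single j (1:ℝ))) = fun y =>
      2 * α * ⟪B y - a, B (EuclideanSpace.single j (1:ℝ))⟫ + 2 * β * (⟪e, y⟫ + c₁) * e j + v j
      + t₀ * v' j := by
    funext y; rw [h1]; simp [EuclideanSpace.inner_single_right]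
  rw [h2]
  have hi : HasFDerivAt (fun z : E n => ⟪e, z⟫) (innerSL ℝ e) x₀ := (innerSL ℝ e).hasFDerivAt
  have hB : HasFDerivAt (fun z => ⟪B (EuclideanSpace.single j (1:ℝ)), B z - a⟫)
      ((innerSL ℝ (B (EuclideanSpace.single j (1:ℝ)))).comp B) x₀ :=
    (innerSL ℝ (B (EuclideanSpace.single j (1:ℝ)))).hasFDerivAt.comp x₀
      (B.hasFDerivAt.sub_const a)
  have h := (((hB.const_mul (2 * α)).add
      (((hi.add_const c₁).const_mul (2 * β)).mul_const (e j))).add_const (v j)).add_const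
      (t₀ * v' j)
  have h' := (h.congr_of_eventuallyEq (f₁ := fun y =>
      2 * α * ⟪B y - a, B (EuclideanSpace.single j (1:ℝ))⟫ + 2 * β * (⟪e, y⟫ + c₁) * e j + v j
      + t₀ * v' j) (Filter.Eventually.of_forall fun z => by simp [real_inner_comm])).fderiv
  rw [h']
  simp [EuclideanSpace.inner_single_right, real_inner_comm]
  ring


lemma hessMatrix_quad' {φ : E n → ℝ → ℝ} {M : Matrix (Fin n) (Fin n) ℝ} {α β c₁ c₂ c₃ : ℝ}
    {a e v v' : E n}
    (hφ : ∀ x t, φ x t = α * ‖Matrix.toEuclideanCLM (𝕜 := ℝ) M x - a‖ ^ 2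
      + β * (⟪e, x⟫ + c₁) ^ 2 + (⟪v, x⟫ + c₂) + t * (⟪v', x⟫ + c₃)) (x₀ : E n) (t₀ : ℝ) :
    hessMatrix φ x₀ t₀ = (2 * α) • (M.transpose * M)
      + (2 * β) • Matrix.vecMulVec e.ofLp e.ofLp := by
  ext i j
  rw [hessMatrix_quad hφ]
  simp [Matrix.mul_apply, Matrix.vecMulVec_apply, PiLp.inner_apply, EuclideanSpace.single, 
    Matrix.ofLp_toEuclideanCLM]
  left
  exact Finset.sum_congr rfl fun _ _ => mul_comm _ _

lemma posSemidef_quad (M : Matrix (Fin n) (Fin n) ℝ) (e : Fin n → ℝ) {α β : ℝ} (hα : 0 ≤ α)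
    (hβ : 0 ≤ β) : (α • (M.transpose * M) + β • Matrix.vecMulVec e e).PosSemidef := by
  have h1 := Matrix.posSemidef_conjTranspose_mul_self M
  have h2 := Matrix.posSemidef_vecMulVec_self_star e
  simp only [Matrix.conjTranspose_eq_transpose_of_trivial, star_trivial] at h1 h2
  exact (h1.smul hα).add (h2.smul hβ)

/-- Determinant of a rank-one perturbation of `α MᵀM`. -/
lemma det_quad (V : Matrix (Fin n) (Fin n) ℝ) (hV : V.det ≠ 0) (e : Fin n → ℝ) {α : ℝ} (β : ℝ)
    (hα : 0 < α) :
    (α • (V⁻¹.transpose * V⁻¹) + β • Matrix.vecMulVec e e).det =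
      α ^ n * (V.det⁻¹) ^ 2 *
        (1 + β / α * dotProduct (V.transpose.mulVec e) (V.transpose.mulVec e)) := by
  have hu : IsUnit V.det := isUnit_iff_ne_zero.2 hV
  have h1 : α • (V⁻¹.transpose * V⁻¹) + β • Matrix.vecMulVec e e =
      V⁻¹.transpose * ((α • (1 : Matrix (Fin n) (Fin n) ℝ)) *
        (1 + (Matrix.replicateCol Unit ((β / α) • V.transpose.mulVec e)) *
          (Matrix.replicateRow Unit (V.transpose.mulVec e)))) * V⁻¹ := by
    rw [← Matrix.vecMulVec_eq, Matrix.smul_mul, Matrix.one_mul, smul_add, Matrix.mul_add,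
      Matrix.add_mul, Matrix.mul_smul, Matrix.smul_mul, Matrix.mul_one, Matrix.smul_vecMulVec,
      smul_smul, mul_div_cancel₀ _ hα.ne', Matrix.mul_smul, Matrix.smul_mul, Matrix.mul_vecMulVec,
      Matrix.vecMulVec_mul, Matrix.mulVec_mulVec, ← Matrix.transpose_mul,
      Matrix.mul_nonsing_inv _ hu, Matrix.mulVec_transpose V e, Matrix.vecMul_vecMul,
      Matrix.mul_nonsing_inv _ hu]
    simp
  rw [h1, Matrix.det_mul, Matrix.det_mul, Matrix.det_mul, Matrix.det_smul,
    Matrix.det_one_add_replicateCol_mul_replicateRow,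
    Matrix.det_transpose, Matrix.det_nonsing_inv]
  simp
  ring

/-- Comparison from below with strict classical subsolutions. -/
lemma ViscSupersolution.le_of_strict {lam p a b t₁ t₂ : ℝ} {Ω K : Set (E n)} {u φ : E n → ℝ → ℝ}
    (hu : ViscSupersolution lam p Ω a b u)
    (hc : ContinuousOn (fun q : E n × ℝ => u q.1 q.2) (closure Ω ×ˢ Icc a b))
    (hK : IsCompact K) (hKΩ : K ⊆ Ω) (ha : a ≤ t₁) (hb : t₂ ≤ b)
    (hφc : Continuous (fun q : E n × ℝ => φ q.1 q.2)) (hφ : ∀ x t, IsTestAt φ x t)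
    (hbd : ∀ x ∈ K, ∀ t ∈ Icc t₁ t₂, t = t₁ ∨ K ∉ nhds x → φ x t ≤ u x t)
    (hpsd : ∀ x t, (hessMatrix φ x t).PosSemidef)
    (hst : ∀ x ∈ K, ∀ t, timeDeriv φ x t < lam * (hessMatrix φ x t).det ^ p) :
    ∀ x ∈ K, ∀ t ∈ Icc t₁ t₂, φ x t ≤ u x t := by
  intro y hy s hs
  have hKc : IsCompact (K ×ˢ Icc t₁ t₂) := hK.prod isCompact_Icc
  have hsub : K ×ˢ Icc t₁ t₂ ⊆ closure Ω ×ˢ Icc a b :=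
    prod_mono (hKΩ.trans subset_closure) (Icc_subset_Icc ha hb)
  obtain ⟨⟨x₀, t₀⟩, ⟨hx₀, ht₀⟩, hmin⟩ := hKc.exists_isMinOn ⟨(y, s), hy, hs⟩
    ((hc.mono hsub).sub hφc.continuousOn)
  simp only at hx₀ ht₀
  have hmin' : ∀ x ∈ K, ∀ t ∈ Icc t₁ t₂, u x₀ t₀ - φ x₀ t₀ ≤ u x t - φ x t :=
    fun x hx t ht => hmin (show (x, t) ∈ K ×ˢ Icc t₁ t₂ from ⟨hx, ht⟩)
  by_cases h : t₀ = t₁ ∨ K ∉ nhds x₀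
  · have := hbd x₀ hx₀ t₀ ht₀ h
    have := hmin' y hy s hs
    linarith
  · push Not at h
    obtain ⟨hne, hnh⟩ := h
    have hlt : t₁ < t₀ := lt_of_le_of_ne ht₀.1 (Ne.symm hne)
    obtain ⟨ε, hε, hball⟩ := Metric.mem_nhds_iff.1 hnh
    have h1 := hu x₀ (hKΩ hx₀) t₀ ⟨by linarith, by linarith [ht₀.2]⟩ φ (hφ _ _)
      ⟨min ε (t₀ - t₁), lt_min hε (by linarith), fun x _ t _ htle hdx hdt => by
        refine hmin' x (hball (lt_of_lt_of_le hdx (min_le_left _ _))) t ⟨?_, by linarith [ht₀.2]⟩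
        have := lt_of_lt_of_le hdt (min_le_right _ _)
        rw [Real.dist_eq, abs_lt] at this
        linarith [this.1]⟩ (hpsd _ _)
    exact absurd (hst x₀ hx₀ t₀) (not_lt.2 h1)

/-- Comparison from above with strict classical supersolutions. -/
lemma ViscSubsolution.le_of_strict {Lam p a b t₁ t₂ : ℝ} {Ω K : Set (E n)} {u φ : E n → ℝ → ℝ}
    (hu : ViscSubsolution Lam p Ω a b u)
    (hc : ContinuousOn (fun q : E n × ℝ => u q.1 q.2) (closure Ω ×ˢ Icc a b))
    (hK : IsCompact K) (hKΩ : K ⊆ Ω) (ha : a ≤ t₁) (hb : t₂ ≤ b)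
    (hφc : Continuous (fun q : E n × ℝ => φ q.1 q.2)) (hφ : ∀ x t, IsTestAt φ x t)
    (hbd : ∀ x ∈ K, ∀ t ∈ Icc t₁ t₂, t = t₁ ∨ K ∉ nhds x → u x t ≤ φ x t)
    (hst : ∀ x ∈ K, ∀ t, Lam * max (hessMatrix φ x t).det 0 ^ p < timeDeriv φ x t) :
    ∀ x ∈ K, ∀ t ∈ Icc t₁ t₂, u x t ≤ φ x t := by
  intro y hy s hs
  have hKc : IsCompact (K ×ˢ Icc t₁ t₂) := hK.prod isCompact_Icc
  have hsub : K ×ˢ Icc t₁ t₂ ⊆ closure Ω ×ˢ Icc a b :=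
    prod_mono (hKΩ.trans subset_closure) (Icc_subset_Icc ha hb)
  obtain ⟨⟨x₀, t₀⟩, ⟨hx₀, ht₀⟩, hmax⟩ := hKc.exists_isMaxOn ⟨(y, s), hy, hs⟩
    ((hc.mono hsub).sub hφc.continuousOn)
  simp only at hx₀ ht₀
  have hmax' : ∀ x ∈ K, ∀ t ∈ Icc t₁ t₂, u x t - φ x t ≤ u x₀ t₀ - φ x₀ t₀ :=
    fun x hx t ht => hmax (show (x, t) ∈ K ×ˢ Icc t₁ t₂ from ⟨hx, ht⟩)
  by_cases h : t₀ = t₁ ∨ K ∉ nhds x₀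
  · have := hbd x₀ hx₀ t₀ ht₀ h
    have := hmax' y hy s hs
    linarith
  · push Not at h
    obtain ⟨hne, hnh⟩ := h
    have hlt : t₁ < t₀ := lt_of_le_of_ne ht₀.1 (Ne.symm hne)
    obtain ⟨ε, hε, hball⟩ := Metric.mem_nhds_iff.1 hnh
    have h1 := hu x₀ (hKΩ hx₀) t₀ ⟨by linarith, by linarith [ht₀.2]⟩ φ (hφ _ _)
      ⟨min ε (t₀ - t₁), lt_min hε (by linarith), fun x _ t _ htle hdx hdt => by
        refine hmax' x (hball (lt_of_lt_of_le hdx (min_le_left _ _))) t ⟨?_, by linarith [ht₀.2]⟩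
        have := lt_of_lt_of_le hdt (min_le_right _ _)
        rw [Real.dist_eq, abs_lt] at this
        linarith [this.1]⟩
    exact absurd (hst x₀ hx₀ t₀) (not_lt.2 h1)


lemma toEuclideanCLM_inv_apply (V : Matrix (Fin n) (Fin n) ℝ) (hV : V.det ≠ 0) (x : E n) :
    Matrix.toEuclideanCLM (𝕜 := ℝ) V⁻¹ (Matrix.toEuclideanCLM (𝕜 := ℝ) V x) = x := by
  rw [← mul_apply_eq_comp, ← map_mul,
    Matrix.nonsing_inv_mul _ (isUnit_iff_ne_zero.2 hV), map_one]
  rfl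

lemma toEuclideanCLM_apply_inv (V : Matrix (Fin n) (Fin n) ℝ) (hV : V.det ≠ 0) (x : E n) :
    Matrix.toEuclideanCLM (𝕜 := ℝ) V (Matrix.toEuclideanCLM (𝕜 := ℝ) V⁻¹ x) = x := by
  rw [← mul_apply_eq_comp, ← map_mul,
    Matrix.mul_nonsing_inv _ (isUnit_iff_ne_zero.2 hV), map_one]
  rfl

/-- A viscosity subsolution lying well below an affine function on an ellipsoid at one time stays
below it at the centre for a time controlled by the volume of the ellipsoid. -/
lemma ViscSubsolution.le_sub_half {Lam p a b t t₁ ρ d c : ℝ} {Ω : Set (E n)} {u : E n → ℝ → ℝ}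
    (hu : ViscSubsolution Lam p Ω a b u)
    (hc : ContinuousOn (fun q : E n × ℝ => u q.1 q.2) (closure Ω ×ˢ Icc a b))
    {V : Matrix (Fin n) (Fin n) ℝ} (hV : V.det ≠ 0) {z v : E n} (hρ : 0 < ρ) (hd : 0 < d)
    (ha : a ≤ t) (ht : t < t₁) (hb : t₁ ≤ b)
    (hΩ : ∀ μ : E n, ‖μ‖ ≤ ρ → z + Matrix.toEuclideanCLM (𝕜 := ℝ) V μ ∈ Ω)
    (hle : ∀ x ∈ Ω, ∀ μ : E n, ‖μ‖ ≤ ρ → x = z + Matrix.toEuclideanCLM (𝕜 := ℝ) V μ →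
      ∀ τ ∈ Icc t t₁, u x τ ≤ ⟪v, x⟫ + c)
    (hlt : ∀ x ∈ Ω, ∀ μ : E n, ‖μ‖ ≤ ρ → x = z + Matrix.toEuclideanCLM (𝕜 := ℝ) V μ →
      u x t ≤ ⟪v, x⟫ + c - d)
    (hsm : (t₁ - t) * (Lam * ((4 * d / ρ ^ 2) ^ n * V.det⁻¹ ^ 2) ^ p) < d / 2) :
    u z t₁ ≤ ⟪v, z⟫ + c - d / 2 := by
  set A := Matrix.toEuclideanCLM (𝕜 := ℝ) V with hA
  set B := Matrix.toEuclideanCLM (𝕜 := ℝ) V⁻¹ with hB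
  have hBA : ∀ x, B (A x) = x := toEuclideanCLM_inv_apply V hV
  have hAB : ∀ x, A (B x) = x := toEuclideanCLM_apply_inv V hV
  have htt : 0 < t₁ - t := by linarith
  set G : ℝ := d / (2 * (t₁ - t)) with hG
  have hG0 : 0 < G := by positivity
  have hGt : G * (t₁ - t) = d / 2 := by rw [hG]; field_simp
  set φ : E n → ℝ → ℝ := fun x τ => 2 * d / ρ ^ 2 * ‖B x - B z‖ ^ 2
      + 0 * (⟪(0 : E n), x⟫ + 0) ^ 2 + (⟪v, x⟫ + (c - d - G * t)) + τ * (⟪(0 : E n), x⟫ + G)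
    with hφdef
  have hφ : ∀ x τ, φ x τ = 2 * d / ρ ^ 2 * ‖B x - B z‖ ^ 2
      + 0 * (⟪(0 : E n), x⟫ + 0) ^ 2 + (⟪v, x⟫ + (c - d - G * t)) + τ * (⟪(0 : E n), x⟫ + G) :=
    fun _ _ => rfl
  have hφ' : ∀ x τ, φ x τ = 2 * d * (‖B x - B z‖ ^ 2 / ρ ^ 2) + (⟪v, x⟫ + c - d) + G * (τ - t) := by
    intro x τ; rw [hφ]; simp; ring
  set K : Set (E n) := (fun μ => z + A μ) '' closedBall 0 ρ with hKdef
  have hK : IsCompact K := (isCompact_closedBall 0 ρ).image (continuous_const.add A.continuous)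
  have hKmem : ∀ x, ‖B x - B z‖ ≤ ρ → x ∈ K := fun x hx =>
    ⟨B x - B z, by simpa using hx, by simp [hAB]⟩
  have hKΩ : K ⊆ Ω := by
    rintro _ ⟨μ, hμ, rfl⟩
    exact hΩ μ (by simpa using hμ)
  have hφc : Continuous (fun q : E n × ℝ => φ q.1 q.2) := by
    simp only [hφ']
    fun_prop
  have hmain := hu.le_of_strict (t₁ := t) (t₂ := t₁) (φ := φ) hc hK hKΩ ha hb hφc
    (isTestAt_quad hφ) ?_ ?_ z (hKmem z (by simpa using hρ.le)) t₁
      ⟨ht.le, le_rfl⟩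
  · rw [hφ', hGt] at hmain
    simp only [sub_self, norm_zero] at hmain
    norm_num at hmain
    linarith
  · rintro x ⟨μ, hμ, rfl⟩ τ hτ hor
    rw [mem_closedBall_zero_iff] at hμ
    have hxΩ := hΩ μ hμ
    have hBx : B (z + A μ) - B z = μ := by simp [hBA]
    simp only
    rw [hφ', hBx]
    have hGτ : 0 ≤ G * (τ - t) := mul_nonneg hG0.le (by linarith [hτ.1])
    rcases hor with rfl | hnh
    · have := hlt _ hxΩ μ hμ rfl
      have : 0 ≤ 2 * d * (‖μ‖ ^ 2 / ρ ^ 2) := by positivity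
      linarith
    · have hμρ : ‖μ‖ = ρ := by
        by_contra hne
        refine hnh (Filter.mem_of_superset ?_ (fun x (hx : ‖B x - B z‖ < ρ) => hKmem x hx.le))
        have ho : IsOpen {x : E n | ‖B x - B z‖ < ρ} :=
          isOpen_lt (by fun_prop) continuous_const
        refine ho.mem_nhds ?_
        simp only [mem_ofPred_eq]
        rw [hBx]
        exact lt_of_le_of_ne hμ hne
      have := hle _ hxΩ μ hμ rfl τ hτ
      rw [hμρ, div_self (by positivity)]
      linarith
  · intro x _ τ
    rw [timeDeriv_quad hφ, hessMatrix_quad' hφ, det_quad V hV _ _ (by positivity), inner_zero_left,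
      zero_add]
    have hsm' : Lam * ((4 * d / ρ ^ 2) ^ n * V.det⁻¹ ^ 2) ^ p < G := by
      rw [hG, lt_div_iff₀ (by positivity)]
      linarith
    convert hsm' using 3
    rw [max_eq_left] <;> simp only [mul_zero, zero_div, zero_mul, add_zero, mul_one]
    · congr 2; ring
    · positivity


/-- An inscribed simplex of maximal volume gives a John-type position of a convex body. -/
lemma exists_simplex_position {P : Set (E n)} (hPc : IsCompact P) (hPv : Convex ℝ P) {y : E n}
    (hy : y ∈ interior P) :
    ∃ (V : Matrix (Fin n) (Fin n) ℝ) (a c : E n), V.det ≠ 0 ∧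
      (∀ x ∈ P, ‖Matrix.toEuclideanCLM (𝕜 := ℝ) V⁻¹ (x - a)‖ ^ 2 ≤ n) ∧
      (∀ μ : E n, ‖μ‖ ≤ 1 / (n * (n + 1)) → c + Matrix.toEuclideanCLM (𝕜 := ℝ) V μ ∈ P) := by
  set M : E n × (Fin n → E n) → Matrix (Fin n) (Fin n) ℝ :=
    fun q => Matrix.of fun i j => (q.2 j - q.1) i with hM
  have hMc : Continuous fun q => |(M q).det| := by
    refine continuous_abs.comp (Continuous.matrix_det ?_)
    refine continuous_matrix fun i j => ?_
    simp only [hM, Matrix.of_apply]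
    fun_prop
  have hyP := interior_subset hy
  have hcomp : IsCompact (P ×ˢ Set.pi univ (fun _ : Fin n => P)) :=
    hPc.prod (isCompact_univ_pi fun _ => hPc)
  obtain ⟨⟨a, f⟩, ⟨ha, hf⟩, hmax⟩ := hcomp.exists_isMaxOn
    ⟨(y, fun _ => y), hyP, fun _ _ => hyP⟩ hMc.continuousOn
  simp only at ha hf
  have hf' : ∀ i, f i ∈ P := fun i => hf i (mem_univ i)
  have hmax' : ∀ (a' : E n) (f' : Fin n → E n), a' ∈ P → (∀ i, f' i ∈ P) →
      |(M (a', f')).det| ≤ |(M (a, f)).det| := fun a' f' ha' hf'' =>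
    hmax (show (a', f') ∈ P ×ˢ Set.pi univ (fun _ : Fin n => P) from ⟨ha', fun i _ => hf'' i⟩)
  set V := M (a, f) with hVdef
  have hV : V.det ≠ 0 := by
    obtain ⟨δ, hδ, hball⟩ := Metric.mem_nhds_iff.1 (mem_interior_iff_mem_nhds.1 hy)
    have h := hmax' y (fun j => y + (δ / 2) • EuclideanSpace.single j (1 : ℝ)) hyP (fun i =>
      hball (by
        rw [mem_ball_iff_norm, add_sub_cancel_left, norm_smul, PiLp.norm_single]
        rw [Real.norm_of_nonneg (by positivity)]
        norm_num; exact hδ))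
    have hm : M (y, fun j => y + (δ / 2) • EuclideanSpace.single j (1 : ℝ)) =
        (δ / 2) • (1 : Matrix (Fin n) (Fin n) ℝ) := by
      ext i j
      simp [hM, Matrix.one_apply, EuclideanSpace.single]
    rw [hm, Matrix.det_smul, Matrix.det_one] at h
    have h0 : 0 < |(δ / 2) ^ Fintype.card (Fin n) * 1| := by positivity
    exact abs_pos.1 (h0.trans_le h)
  have hA : ∀ μ : E n, Matrix.toEuclideanCLM (𝕜 := ℝ) V μ = ∑ i, μ i • (f i - a) := by
    intro μ
    ext k
    rw [Matrix.ofLp_toEuclideanCLM]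
    simp [Matrix.mulVec, dotProduct, hVdef, hM, mul_comm]
  refine ⟨V, a, a + Matrix.toEuclideanCLM (𝕜 := ℝ) V (WithLp.toLp 2 fun _ => 1 / ((n : ℝ) + 1)),
    hV, fun x hx => ?_, fun μ hμ => ?_⟩
  · set μ := Matrix.toEuclideanCLM (𝕜 := ℝ) V⁻¹ (x - a) with hμ
    have hi : ∀ i, |μ i| ≤ 1 := by
      intro i
      have h1 : V.det * μ i = (V.updateCol i (x - a).ofLp).det := by
        rw [← Matrix.cramer_apply, hμ, Matrix.ofLp_toEuclideanCLM, Matrix.inv_def]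
        simp [Matrix.smul_mulVec, Ring.inverse_eq_inv', hV, Matrix.cramer_eq_adjugate_mulVec]
      have h2 : V.updateCol i (x - a).ofLp = M (a, Function.update f i x) := by
        ext k j
        by_cases hj : j = i
        · subst hj; simp [hM]
        · simp [hM, hVdef, hj]
      have h3 := hmax' a (Function.update f i x) ha (fun j => by
        by_cases hj : j = i
        · subst hj; simpa using hx
        · simpa [hj] using hf' j)
      rw [← h2, ← h1, abs_mul] at h3
      exact le_of_mul_le_mul_left (by simpa using h3) (abs_pos.2 hV)
    rw [EuclideanSpace.norm_sq_eq]
    calc ∑ i, ‖μ i‖ ^ 2 ≤ ∑ i : Fin n, (1 : ℝ) := Finset.sum_le_sum fun i _ => by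
          rw [Real.norm_eq_abs]; exact pow_le_one₀ (abs_nonneg _) (hi i)
      _ = n := by simp
  · set w : Fin n → ℝ := fun i => 1 / ((n : ℝ) + 1) + μ i with hw
    have hi : ∀ i, |μ i| ≤ 1 / (n * (n + 1)) := fun i => by
      rw [← Real.norm_eq_abs]; exact (PiLp.norm_apply_le μ i).trans hμ
    have hpos : ∀ i, 0 ≤ w i := by
      intro i
      have hn : (1 : ℝ) ≤ n := by exact_mod_cast (Nat.one_le_iff_ne_zero.2 (by
        rintro rfl; exact i.elim0))
      have h1 : 1 / ((n : ℝ) * (n + 1)) ≤ 1 / ((n : ℝ) + 1) :=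
        one_div_le_one_div_of_le (by positivity) (by nlinarith)
      have := (abs_le.1 (hi i)).1
      simp only [hw]
      linarith
    have hsum : ∑ i, w i ≤ 1 := by
      calc ∑ i, w i ≤ ∑ i : Fin n, (1 / ((n : ℝ) + 1) + 1 / (n * (n + 1))) :=
            Finset.sum_le_sum fun i _ => by
              have := (abs_le.1 (hi i)).2
              simp only [hw]; linarith
        _ = n * (1 / ((n : ℝ) + 1) + 1 / (n * (n + 1))) := by simp [mul_add]
        _ ≤ 1 := by
            rcases Nat.eq_zero_or_pos n with h0 | h0
            · subst h0; norm_num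
            · have : (0 : ℝ) < n := by exact_mod_cast h0
              rw [← sub_nonneg]
              apply le_of_eq
              field_simp
              ring
    have := hPv.sum_mem (t := Finset.univ) (w := Fin.cons (1 - ∑ i, w i) w)
      (z := (Fin.cons a f : Fin (n + 1) → E n))
      (fun i _ => by
        refine Fin.cases ?_ (fun i => ?_) i
        · simpa using hsum
        · simpa using hpos i)
      (by simp [Fin.sum_univ_succ])
      (fun i _ => by
        refine Fin.cases ?_ (fun i => ?_) i
        · simpa using ha
        · simpa using hf' i)
    convert this using 1
    rw [hA, hA, Fin.sum_univ_succ]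
    simp only [Fin.cons_zero, Fin.cons_succ, hw, smul_sub, sub_smul, one_smul, add_smul,
      Finset.sum_add_distrib, Finset.sum_sub_distrib, Finset.sum_smul]
    abel


lemma IsCompact.convexJoin' {s t : Set (E n)} (hs : IsCompact s) (ht : IsCompact t) :
    IsCompact (convexJoin ℝ s t) := by
  have : convexJoin ℝ s t = (fun q : (E n × E n) × ℝ => (1 - q.2) • q.1.1 + q.2 • q.1.2) ''
      ((s ×ˢ t) ×ˢ Icc (0 : ℝ) 1) := by
    ext x
    simp only [mem_convexJoin, segment_eq_image, mem_image, mem_prod, Prod.exists]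
    constructor
    · rintro ⟨a, ha, b, hb, θ, hθ, rfl⟩
      exact ⟨a, b, θ, ⟨⟨ha, hb⟩, hθ⟩, rfl⟩
    · rintro ⟨a, b, θ, ⟨⟨ha, hb⟩, hθ⟩, rfl⟩
      exact ⟨a, ha, b, hb, θ, hθ, rfl⟩
  rw [this]
  exact ((hs.prod ht).prod isCompact_Icc).image (by fun_prop)

/-- Finitely many compact convex subsets missing an extreme point lie in one such subset. -/
lemma exists_convex_superset_of_extreme {K : Set (E n)} (hK : Convex ℝ K) {x₀ : E n}
    (hx : x₀ ∈ K.extremePoints ℝ) {ι : Type*} (I : Finset ι) (C : ι → Set (E n))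
    (hC : ∀ i ∈ I, IsCompact (C i) ∧ Convex ℝ (C i) ∧ C i ⊆ K ∧ x₀ ∉ C i) :
    ∃ A : Set (E n), IsCompact A ∧ Convex ℝ A ∧ A ⊆ K ∧ x₀ ∉ A ∧ ∀ i ∈ I, C i ⊆ A := by
  classical
  induction I using Finset.induction_on with
  | empty => exact ⟨∅, isCompact_empty, convex_empty, empty_subset _, notMem_empty _, by simp⟩
  | insert i I _ ih =>
    obtain ⟨A, hAc, hAv, hAK, hxA, hA⟩ := ih fun j hj => hC j (Finset.mem_insert_of_mem hj)
    obtain ⟨hc, hv, hcK, hxc⟩ := hC i (Finset.mem_insert_self _ _)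
    rcases A.eq_empty_or_nonempty with rfl | hAne
    · exact ⟨C i, hc, hv, hcK, hxc, fun j hj => by
        rcases Finset.mem_insert.1 hj with rfl | hj
        · rfl
        · exact (hA j hj).trans (empty_subset _)⟩
    rcases (C i).eq_empty_or_nonempty with he | hne
    · exact ⟨A, hAc, hAv, hAK, hxA, fun j hj => by
        rcases Finset.mem_insert.1 hj with rfl | hj
        · rw [he]; exact empty_subset _
        · exact hA j hj⟩
    refine ⟨convexJoin ℝ A (C i), hAc.convexJoin' hc, hAv.convexJoin hv,
      convexJoin_subset hAK hcK hK, fun hmem => ?_, fun j hj => ?_⟩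
    · obtain ⟨a, ha, b, hb, hs⟩ := mem_convexJoin.1 hmem
      have h1 : a ≠ x₀ := fun h => hxA (h ▸ ha)
      have h2 : b ≠ x₀ := fun h => hxc (h ▸ hb)
      have := mem_openSegment_of_ne_left_right h1 h2 hs
      exact h1 ((mem_extremePoints.1 hx).2 a (hAK ha) b (hcK hb) this).1
    · rcases Finset.mem_insert.1 hj with rfl | hj
      · exact subset_convexJoin_right hAne
      · exact (hA j hj).trans (subset_convexJoin_left hne)

/-- Near every extreme point of a compact convex set there is a farthest point from some centre,
at which the set is supported quadratically. -/
lemma exists_quadratic_support {K : Set (E n)} (hKc : IsCompact K) (hK : Convex ℝ K) {x₀ : E n}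
    (hx : x₀ ∈ K.extremePoints ℝ) {δ : ℝ} (hδ : 0 < δ) :
    ∃ z ∈ K, dist z x₀ < δ ∧ ∃ e : E n, ∀ x ∈ K, ⟪e, x - z⟫ ≤ -‖x - z‖ ^ 2 / 2 := by
  have hx₀ := (mem_extremePoints.1 hx).1
  obtain ⟨R, hR⟩ := hKc.isBounded.subset_closedBall x₀
  have hcK : IsCompact (K \ ball x₀ δ) := hKc.diff isOpen_ball
  obtain ⟨I, hIs, hI⟩ := hcK.elim_finite_subcover_image (b := K \ ball x₀ δ)
    (c := fun y => ball y (δ / 2)) (fun _ _ => isOpen_ball)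
    (fun y hy => mem_biUnion hy (mem_ball_self (by positivity)))
  obtain ⟨hIf, hIcov⟩ := hI
  obtain ⟨A, hAc, hAv, hAK, hxA, hA⟩ := exists_convex_superset_of_extreme hK hx hIf.toFinset
    (fun y => K ∩ closedBall y (δ / 2)) (fun y hy => by
      have hy' := hIs (hIf.mem_toFinset.1 hy)
      refine ⟨hKc.inter_right isClosed_closedBall, hK.inter (convex_closedBall _ _),
        inter_subset_left, fun hmem => hy'.2 ?_⟩
      have := hmem.2
      rw [mem_closedBall] at this
      rw [mem_ball']
      linarith)
  have hcov : K \ ball x₀ δ ⊆ A := fun x hx' => by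
    obtain ⟨y, hy, hxy⟩ := mem_iUnion₂.1 (hIcov hx')
    exact hA y (hIf.mem_toFinset.2 hy) ⟨hx'.1, ball_subset_closedBall hxy⟩
  obtain ⟨f, α, hfα, hα⟩ := geometric_hahn_banach_point_closed hAv hAc.isClosed hxA
  set g := (InnerProductSpace.toDual ℝ (E n)).symm f with hg
  have hgf : ∀ x, ⟪g, x⟫ = f x := fun x => InnerProductSpace.toDual_symm_apply
  set η := α - f x₀ with hη
  have hη0 : 0 < η := by linarith
  set L := R ^ 2 / η + 1 with hL
  have hL0 : 0 < L := by positivity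
  set c := x₀ + L • g with hc
  obtain ⟨z, hz, hzmax⟩ := hKc.exists_isMaxOn ⟨x₀, hx₀⟩
    (f := fun x => ‖x - c‖) (by fun_prop)
  have hzm : ∀ x ∈ K, ‖x - c‖ ^ 2 ≤ ‖z - c‖ ^ 2 := fun x hx' =>
    pow_le_pow_left₀ (norm_nonneg _) (hzmax hx') 2
  refine ⟨z, hz, ?_, z - c, fun x hx' => ?_⟩
  · by_contra hnot
    have hzA : z ∈ A := hcov ⟨hz, hnot⟩
    have h1 := hzm x₀ hx₀
    have h2 : ‖z - c‖ ^ 2 = ‖z - x₀‖ ^ 2 - 2 * L * (f z - f x₀) + ‖x₀ - c‖ ^ 2 := by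
      have e1 : z - c = (z - x₀) - L • g := by rw [hc]; abel
      have e2 : x₀ - c = - (L • g) := by rw [hc]; abel
      rw [e1, e2, norm_neg, norm_sub_sq_real, inner_smul_right, real_inner_comm, inner_sub_right,
        hgf, hgf]
      ring
    have h3 : ‖z - x₀‖ ≤ R := by simpa [dist_eq_norm] using hR hz
    have h4 : ‖z - x₀‖ ^ 2 ≤ R ^ 2 := pow_le_pow_left₀ (norm_nonneg _) h3 2
    have h5 : η < f z - f x₀ := by have := hα z hzA; linarith
    have h6 : L * η = R ^ 2 + η := by rw [hL]; field_simp
    have h7 : L * η < L * (f z - f x₀) := mul_lt_mul_of_pos_left h5 hL0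
    nlinarith [sq_nonneg R]
  · have h1 := hzm x hx'
    have e1 : x - c = (x - z) + (z - c) := by abel
    rw [e1, norm_add_sq_real, real_inner_comm] at h1
    linarith


/-- Existence of a subgradient of a continuous convex function on an open set. -/
lemma ConvexOn.exists_subgradient {Ω : Set (E n)} (hΩ : IsOpen Ω) {f : E n → ℝ}
    (hf : ConvexOn ℝ Ω f) (hc : ContinuousOn f Ω) {y : E n} (hy : y ∈ Ω) :
    ∃ q : E n, ∀ x ∈ Ω, f y + ⟪q, x - y⟫ ≤ f x := by
  have ho : IsOpen {q : E n × ℝ | q.1 ∈ Ω ∧ f q.1 < q.2} := by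
    rw [isOpen_iff_mem_nhds]
    rintro ⟨x, r⟩ ⟨hx, hr⟩
    have h1 : ∀ᶠ q : E n × ℝ in nhds (x, r), q.1 ∈ Ω :=
      (continuous_fst.continuousAt).eventually (hΩ.mem_nhds hx)
    have h2 : ContinuousAt (fun q : E n × ℝ => f q.1) (x, r) :=
      ContinuousAt.comp (f := Prod.fst) (hc.continuousAt (hΩ.mem_nhds hx)) continuousAt_fst
    have h3 : ∀ᶠ q : E n × ℝ in nhds (x, r), f q.1 < q.2 :=
      h2.eventually_lt continuousAt_snd hr
    exact h1.and h3
  obtain ⟨F, hF⟩ := geometric_hahn_banach_open_point hf.convex_strict_epigraph ho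
    (x := (y, f y)) (by simp)
  have hsplit : ∀ (x : E n) (r : ℝ), F (x, r) = F (x, 0) + r * F (0, 1) := by
    intro x r
    have : ((x, r) : E n × ℝ) = (x, 0) + r • ((0 : E n), (1 : ℝ)) := by simp
    rw [this, map_add, map_smul, smul_eq_mul]
  set β := F (0, 1) with hβ
  have hβ0 : β < 0 := by
    have := hF (y, f y + 1) ⟨hy, by simp⟩
    rw [hsplit, hsplit y (f y)] at this
    linarith
  set G : E n →L[ℝ] ℝ := F.comp (ContinuousLinearMap.inl ℝ (E n) ℝ) with hG
  refine ⟨(InnerProductSpace.toDual ℝ (E n)).symm ((-β)⁻¹ • G), fun x hx => ?_⟩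
  rw [InnerProductSpace.toDual_symm_apply]
  have h1 : ∀ r, f x < r → F (x, 0) + r * β < F (y, 0) + f y * β := fun r hr => by
    have := hF (x, r) ⟨hx, hr⟩
    rwa [hsplit, hsplit y] at this
  have h2 : F (x, 0) + f x * β ≤ F (y, 0) + f y * β := by
    refine le_of_forall_pos_le_add fun ε hε => ?_
    have := h1 (f x + ε / (-β)) (by have : 0 < -β := by linarith
                                    have := div_pos hε this
                                    linarith)
    have h3 : ε / (-β) * β = -ε := by
      rw [div_neg, neg_mul, div_mul_cancel₀ _ hβ0.ne]
    linarith [add_mul (f x) (ε / (-β)) β]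
  have h3 : G (x - y) = F (x, 0) - F (y, 0) := by
    rw [← map_sub]; simp [hG]
  have h4 : ((-β)⁻¹ • G) (x - y) = (F (x, 0) - F (y, 0)) / (-β) := by
    simp [← h3, div_eq_inv_mul]
  rw [h4, ← le_sub_iff_add_le', div_le_iff₀ (by linarith)]
  linarith


/-- A solution vanishing at time zero on the segment from `x₀` to `2 y₀ - x₀`, whose zero set near
`x₀` lies below the paraboloid with axis `e`. -/
structure TouchingConfig (lam Lam p T : ℝ) (Ω : Set (E n)) (u : E n → ℝ → ℝ)
    (x₀ y₀ e : E n) (r b : ℝ) : Prop where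
  isOpen : IsOpen Ω
  convex : Convex ℝ Ω
  pos_p : 0 < p
  pos_lam : 0 < lam
  pos_Lam : 0 < Lam
  pos_T : 0 < T
  sol : ViscositySolution lam Lam p Ω (-T) 0 u
  nonneg : ∀ x ∈ Ω, 0 ≤ u x 0
  pos_r : 0 < r
  pos_b : 0 < b
  ball_subset : closedBall x₀ r ⊆ Ω
  zero_x : u x₀ 0 = 0
  mem_y : y₀ + (y₀ - x₀) ∈ Ω
  zero_y : u (y₀ + (y₀ - x₀)) 0 = 0
  inner_y : ⟪e, y₀ - x₀⟫ = -b / 2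
  norm_y : ‖y₀ - x₀‖ < r
  b_lt : 2 * b < r ^ 2 / 4
  supp : ∀ x ∈ closedBall x₀ r, u x 0 = 0 → ⟪e, x - x₀⟫ ≤ -‖x - x₀‖ ^ 2 / 2

/-- Sections of the solution just before time zero, cut by nearly supporting planes tilted towards
`x₀`, stay in a thin slab near `x₀`. -/
lemma TouchingConfig.section_bound {lam Lam p T : ℝ} {Ω : Set (E n)} {u : E n → ℝ → ℝ}
    {x₀ y₀ e : E n} {r b : ℝ} (h : TouchingConfig lam Lam p T Ω u x₀ y₀ e r b) {θ : ℝ}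
    (hθ : 0 < θ) :
    ∃ M > (0 : ℝ), ∃ t₀ < (0 : ℝ), -T ≤ t₀ ∧ ∃ ε₀ > (0 : ℝ), ∀ t ∈ Icc t₀ 0, ∀ (q : E n) (s ε : ℝ),
      s ≤ ε → 0 < ε → ε ≤ ε₀ → (∀ x ∈ closedBall x₀ r, -s + ⟪q, x - y₀⟫ ≤ u x t) →
      ε * M ≤ 1 / 2 ∧ ∀ x ∈ closedBall x₀ r, -b ≤ ⟪e, x - x₀⟫ →
        u x t ≤ (1 - ε * M) * ⟪q, x - y₀⟫ + ε * ((⟪e, x - x₀⟫ + b) / b) →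
        ⟪e, x - x₀⟫ ≤ θ * b ∧ ‖x - x₀‖ < r / 2 ∧ -(1 / 24) ≤ M * ⟪q, x - y₀⟫ := by
  have hb := h.pos_b
  have hr := h.pos_r
  have hcont := h.sol.1.cont
  have hT := h.pos_T
  have hcl : closedBall x₀ r ⊆ closure Ω := h.ball_subset.trans subset_closure
  have hc0 : ContinuousOn (fun x => u x 0) (closedBall x₀ r) :=
    hcont.comp (f := fun x => (x, (0 : ℝ))) (by fun_prop)
      (fun x hx => ⟨hcl hx, by linarith, le_rfl⟩)
  set X : Set (E n) := closedBall x₀ r ∩ ({x | -b ≤ ⟪e, x - x₀⟫} ∩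
    ({x | θ * b ≤ ⟪e, x - x₀⟫} ∪ {x | r / 2 ≤ ‖x - x₀‖})) with hX
  have hXc : IsCompact X := by
    refine (isCompact_closedBall x₀ r).inter_right (IsClosed.inter ?_ (IsClosed.union ?_ ?_))
    · exact isClosed_le continuous_const (by fun_prop)
    · exact isClosed_le continuous_const (by fun_prop)
    · exact isClosed_le continuous_const (by fun_prop)
  obtain ⟨m, hm0, hm⟩ := hXc.exists_forall_le' (f := fun x => u x 0) (a := 0)
    (hc0.mono inter_subset_left) (fun x hx => by
      refine lt_of_le_of_ne (h.nonneg x (h.ball_subset hx.1)) (fun h0 => ?_)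
      have h1 := h.supp x hx.1 h0.symm
      obtain ⟨_, h2, h3⟩ := hx
      have := sq_nonneg ‖x - x₀‖
      replace h2 : -b ≤ ⟪e, x - x₀⟫ := h2
      rcases h3 with (h3 : θ * b ≤ ⟪e, x - x₀⟫) | (h3 : r / 2 ≤ ‖x - x₀‖)
      · have := mul_pos hθ hb
        linarith
      · have h4 : (r / 2) ^ 2 ≤ ‖x - x₀‖ ^ 2 := pow_le_pow_left₀ (by positivity) h3 2
        have := h.b_lt
        nlinarith)
  set Gm := (‖e‖ * r + b) / b with hGm
  have hGm0 : 0 < Gm := by positivity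
  have hg : ∀ x ∈ closedBall x₀ r, (⟪e, x - x₀⟫ + b) / b ≤ Gm := by
    intro x hx
    rw [mem_closedBall_iff_norm] at hx
    have h1 := real_inner_le_norm e (x - x₀)
    have h2 := mul_le_mul_of_nonneg_left hx (norm_nonneg e)
    rw [hGm]
    gcongr
    linarith
  set M := 4 * (Gm + 1) / m + 1 with hM
  have hM0 : 0 < M := by positivity
  have hMm : M * m = 4 * (Gm + 1) + m := by rw [hM]; field_simp
  set γ := 1 / (96 * M) with hγ
  have hγ0 : 0 < γ := by positivity
  have hγM : γ * M = 1 / 96 := by rw [hγ]; field_simp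
  have hunif := ((isCompact_closedBall x₀ r).prod
    (isCompact_Icc (a := -T) (b := 0))).uniformContinuousOn_of_continuous
    (hcont.mono (prod_mono hcl le_rfl))
  rw [Metric.uniformContinuousOn_iff] at hunif
  obtain ⟨δ, hδ, hunif⟩ := hunif (min (m / 2) γ) (by positivity)
  have hnear : ∀ x ∈ closedBall x₀ r, ∀ t ∈ Icc (max (-T) (-(δ / 2))) 0,
      u x 0 - u x t ≤ min (m / 2) γ := by
    intro x hx t ht
    have h1 := max_le_iff.1 ht.1
    have := hunif (x, 0) ⟨hx, by linarith, le_rfl⟩ (x, t) ⟨hx, h1.1, ht.2⟩ (by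
      rw [dist_prod_same_left, Real.dist_eq, abs_of_nonneg] <;> linarith [h1.2, ht.2])
    rw [Real.dist_eq] at this
    exact ((abs_lt.1 this).2).le
  refine ⟨M, hM0, max (-T) (-(δ / 2)), max_lt (by linarith) (by linarith), le_max_left _ _,
    min (min (m / 4) γ / Gm) (1 / (2 * M)), by positivity, fun t ht q s ε hs hε hε0 hq => ?_⟩
  have hεG : ε * Gm ≤ min (m / 4) γ := by
    rw [← le_div_iff₀ hGm0]; exact hε0.trans (min_le_left _ _)
  have hεM : ε * M ≤ 1 / 2 := by
    have := hε0.trans (min_le_right _ _)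
    rw [le_div_iff₀ (by positivity)] at this
    linarith
  have hε1 : 0 < ε * M := by positivity
  refine ⟨hεM, fun x hx hgx hux => ?_⟩
  have hn := hnear x hx t ht
  have hgx' := mul_le_mul_of_nonneg_left (hg x hx) hε.le
  have hqx := hq x hx
  have hXx : x ∉ X := by
    intro hxX
    have h1 := hm x hxX
    have h2 : m / 2 ≤ u x t := by linarith [min_le_left (m / 2) γ]
    have h3 : m / 4 ≤ (1 - ε * M) * ⟪q, x - y₀⟫ := by linarith [min_le_left (m / 4) γ]
    have h4 : 0 < ⟪q, x - y₀⟫ := by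
      by_contra hneg
      push Not at hneg
      nlinarith
    have h5 : m / 4 ≤ ⟪q, x - y₀⟫ := by nlinarith
    have h6 : ε * (M * ⟪q, x - y₀⟫) ≤ ε * (Gm + 1) := by linarith
    have h7 := le_of_mul_le_mul_left h6 hε
    have h8 := mul_le_mul_of_nonneg_left h5 hM0.le
    linarith
  have hnot : ¬ (θ * b ≤ ⟪e, x - x₀⟫ ∨ r / 2 ≤ ‖x - x₀‖) := fun hor => hXx ⟨hx, hgx, hor⟩
  push Not at hnot
  refine ⟨hnot.1.le, hnot.2, ?_⟩
  have h1 : -γ ≤ u x t := by linarith [min_le_right (m / 2) γ, h.nonneg x (h.ball_subset hx)]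
  have h2 : -(2 * γ) ≤ (1 - ε * M) * ⟪q, x - y₀⟫ := by linarith [min_le_right (m / 4) γ]
  have h3 : -(4 * γ) ≤ ⟪q, x - y₀⟫ := by
    by_contra hneg
    push Not at hneg
    nlinarith
  nlinarith

/-- The section of `u(·,t)` in a half ball cut by an affine function tilted in direction `e`. -/
def tiltedSection (u : E n → ℝ → ℝ) (x₀ y₀ e q : E n) (r b ε σ t : ℝ) : Set (E n) :=
  {x | x ∈ closedBall x₀ r ∧ -b ≤ ⟪e, x - x₀⟫ ∧
    u x t ≤ σ * ⟪q, x - y₀⟫ + ε * ((⟪e, x - x₀⟫ + b) / b)}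

lemma mem_tiltedSection {u : E n → ℝ → ℝ} {x₀ y₀ e q x : E n} {r b ε σ t : ℝ} :
    x ∈ tiltedSection u x₀ y₀ e q r b ε σ t ↔ x ∈ closedBall x₀ r ∧ -b ≤ ⟪e, x - x₀⟫ ∧
      u x t ≤ σ * ⟪q, x - y₀⟫ + ε * ((⟪e, x - x₀⟫ + b) / b) := Iff.rfl

lemma TouchingConfig.continuousOn_slice {lam Lam p T : ℝ} {Ω : Set (E n)} {u : E n → ℝ → ℝ}
    {x₀ y₀ e : E n} {r b : ℝ} (h : TouchingConfig lam Lam p T Ω u x₀ y₀ e r b) {t : ℝ}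
    (ht : t ∈ Icc (-T) 0) : ContinuousOn (fun x => u x t) Ω :=
  h.sol.1.cont.comp (f := fun x => (x, t)) (by fun_prop) (fun _ hx => ⟨subset_closure hx, ht⟩)

lemma TouchingConfig.isCompact_tiltedSection {lam Lam p T : ℝ} {Ω : Set (E n)}
    {u : E n → ℝ → ℝ} {x₀ y₀ e : E n} {r b : ℝ}
    (h : TouchingConfig lam Lam p T Ω u x₀ y₀ e r b) {t : ℝ} (ht : t ∈ Icc (-T) 0)
    (q : E n) (ε σ : ℝ) : IsCompact (tiltedSection u x₀ y₀ e q r b ε σ t) := by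
  have hc := (h.continuousOn_slice ht).mono h.ball_subset
  have h1 : IsClosed {x | x ∈ closedBall x₀ r ∧
      u x t ≤ σ * ⟪q, x - y₀⟫ + ε * ((⟪e, x - x₀⟫ + b) / b)} :=
    isClosed_closedBall.isClosed_le hc (by fun_prop)
  have h2 : IsClosed {x | -b ≤ ⟪e, x - x₀⟫} := isClosed_le continuous_const (by fun_prop)
  refine (isCompact_closedBall x₀ r).of_isClosed_subset ?_ fun x hx => hx.1
  have hset : tiltedSection u x₀ y₀ e q r b ε σ t = {x | x ∈ closedBall x₀ r ∧
      u x t ≤ σ * ⟪q, x - y₀⟫ + ε * ((⟪e, x - x₀⟫ + b) / b)} ∩ {x | -b ≤ ⟪e, x - x₀⟫} := by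
    ext x
    exact ⟨fun hx => ⟨⟨hx.1, hx.2.2⟩, hx.2.1⟩, fun hx => ⟨hx.1.1, hx.2, hx.1.2⟩⟩
  rw [hset]
  exact h1.inter h2

lemma TouchingConfig.convex_tiltedSection {lam Lam p T : ℝ} {Ω : Set (E n)}
    {u : E n → ℝ → ℝ} {x₀ y₀ e : E n} {r b : ℝ}
    (h : TouchingConfig lam Lam p T Ω u x₀ y₀ e r b) {t : ℝ} (ht : t ∈ Icc (-T) 0)
    (q : E n) (ε σ : ℝ) : Convex ℝ (tiltedSection u x₀ y₀ e q r b ε σ t) := by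
  intro x hx y hy α β hα hβ hαβ
  have hcl : closedBall x₀ r ⊆ closure Ω := h.ball_subset.trans subset_closure
  have hlin : ∀ w z : E n, ⟪w, (α • x + β • y) - z⟫ = α * ⟪w, x - z⟫ + β * ⟪w, y - z⟫ := by
    intro w z
    have : (α • x + β • y) - z = α • (x - z) + β • (y - z) := by
      rw [smul_sub, smul_sub, sub_add_sub_comm, ← add_smul, hαβ, one_smul]
    rw [this, inner_add_right, inner_smul_right, inner_smul_right]
  refine ⟨convex_closedBall x₀ r hx.1 hy.1 hα hβ hαβ, ?_, ?_⟩
  · rw [hlin]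
    have h1 : -b ≤ ⟪e, x - x₀⟫ := hx.2.1
    have h2 : -b ≤ ⟪e, y - x₀⟫ := hy.2.1
    have h3 := mul_le_mul_of_nonneg_left h1 hα
    have h4 := mul_le_mul_of_nonneg_left h2 hβ
    have h5 : α * -b + β * -b = -b := by rw [← add_mul, hαβ, one_mul]
    linarith
  · have h1 := (h.sol.1.conv t ht).2 (hcl hx.1) (hcl hy.1) hα hβ hαβ
    simp only [smul_eq_mul] at h1
    have h2 := mul_le_mul_of_nonneg_left hx.2.2 hα
    have h3 := mul_le_mul_of_nonneg_left hy.2.2 hβ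
    have h4 : (α * ⟪e, x - x₀⟫ + β * ⟪e, y - x₀⟫ + b) / b =
        α * ((⟪e, x - x₀⟫ + b) / b) + β * ((⟪e, y - x₀⟫ + b) / b) := by
      have : β = 1 - α := by linarith
      subst this
      ring
    rw [hlin, hlin, h4]
    linarith

/-- If a direction `e` has width at least `b / 2` on a set of normalized size at most `√n`, then its
normalized dual length is bounded below. -/
lemma dotProduct_lower_bound {x₀ y₀ e a : E n} {b : ℝ} (hn : 0 < n)
    {V : Matrix (Fin n) (Fin n) ℝ} (hV : V.det ≠ 0) (hy : ⟪e, y₀ - x₀⟫ = -b / 2)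
    (h1x : ‖Matrix.toEuclideanCLM (𝕜 := ℝ) V⁻¹ (x₀ - a)‖ ^ 2 ≤ n)
    (h1y : ‖Matrix.toEuclideanCLM (𝕜 := ℝ) V⁻¹ (y₀ - a)‖ ^ 2 ≤ n) :
    b ^ 2 / (16 * n) ≤
      dotProduct (V.transpose.mulVec e.ofLp) (V.transpose.mulVec e.ofLp) := by
  have hnR : (0 : ℝ) < n := by exact_mod_cast hn
  set f := V.transpose.mulVec e.ofLp with hf
  set μ := Matrix.toEuclideanCLM (𝕜 := ℝ) V⁻¹ (x₀ - a) -
    Matrix.toEuclideanCLM (𝕜 := ℝ) V⁻¹ (y₀ - a) with hμ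
  have h1 : Matrix.toEuclideanCLM (𝕜 := ℝ) V μ = x₀ - y₀ := by
    rw [hμ, ← map_sub, toEuclideanCLM_apply_inv V hV]
    abel
  have h2 : ⟪WithLp.toLp 2 f, μ⟫ = b / 2 := by
    have : ⟪e, Matrix.toEuclideanCLM (𝕜 := ℝ) V μ⟫ = b / 2 := by
      rw [h1, ← neg_sub, inner_neg_right, hy]
      ring
    rw [← this, hf, real_inner_comm, real_inner_comm _ e]
    simp only [EuclideanSpace.inner_eq_star_dotProduct, star_trivial,
      Matrix.ofLp_toEuclideanCLM, Matrix.mulVec_transpose]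
    rw [Matrix.dotProduct_mulVec]
  have h3 : ‖μ‖ ^ 2 ≤ 4 * n := by
    have := parallelogram_law_with_norm ℝ
      (Matrix.toEuclideanCLM (𝕜 := ℝ) V⁻¹ (x₀ - a)) (Matrix.toEuclideanCLM (𝕜 := ℝ) V⁻¹ (y₀ - a))
    nlinarith [h1x, h1y, sq_nonneg ‖Matrix.toEuclideanCLM (𝕜 := ℝ) V⁻¹ (x₀ - a) +
      Matrix.toEuclideanCLM (𝕜 := ℝ) V⁻¹ (y₀ - a)‖]
  have h4 : dotProduct f f = ‖WithLp.toLp 2 f‖ ^ 2 := by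
    rw [EuclideanSpace.norm_sq_eq]
    simp [dotProduct, sq]
  have h5 : (b / 2) ^ 2 ≤ ‖WithLp.toLp 2 f‖ ^ 2 * ‖μ‖ ^ 2 := by
    rw [← h2, ← mul_pow]
    exact sq_le_sq' (neg_le_of_abs_le (abs_real_inner_le_norm _ _)) (real_inner_le_norm _ _)
  rw [h4, div_le_iff₀ (by positivity)]
  nlinarith [sq_nonneg ‖WithLp.toLp 2 f‖]

set_option maxHeartbeats 1000000 in
/-- The lower barrier: a section pinned in a thin slab forces a bound on its volume in terms of
the time left. -/
lemma TouchingConfig.lower_barrier {lam Lam p T : ℝ} {Ω : Set (E n)} {u : E n → ℝ → ℝ}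
    {x₀ y₀ e : E n} {r b : ℝ} (h : TouchingConfig lam Lam p T Ω u x₀ y₀ e r b)
    {θ t ε σ : ℝ} {q a : E n} (hn : 0 < n) (hθ : 0 < θ) (hθ1 : θ ≤ 1 / 2) (htT : -T ≤ t)
    (ht0 : t < 0) (hε : 0 < ε) (hσ0 : 0 ≤ σ) (hσ1 : σ ≤ 1)
    (hP : ∀ x ∈ tiltedSection u x₀ y₀ e q r b ε σ t, ⟪e, x - x₀⟫ ≤ θ * b ∧ ‖x - x₀‖ < r / 2)
    (hlow : ∀ x ∈ tiltedSection u x₀ y₀ e q r b ε σ t, σ * ⟪q, x - y₀⟫ - ε / 12 ≤ u x t)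
    {V : Matrix (Fin n) (Fin n) ℝ} (hV : V.det ≠ 0)
    (hVP : ∀ x ∈ tiltedSection u x₀ y₀ e q r b ε σ t,
      ‖Matrix.toEuclideanCLM (𝕜 := ℝ) V⁻¹ (x - a)‖ ^ 2 ≤ n)
    (hx₀ : x₀ ∈ tiltedSection u x₀ y₀ e q r b ε σ t)
    (hy₀ : y₀ ∈ tiltedSection u x₀ y₀ e q r b ε σ t) (hq : -(ε / 24) ≤ ⟪q, x₀ - y₀⟫) :
    -t * (lam * ((1 / (12 * n)) ^ n / (64 * θ ^ 2) * (ε ^ n * V.det⁻¹ ^ 2)) ^ p) ≤ ε := by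
  by_contra hcon
  push Not at hcon
  have hb := h.pos_b
  have hr := h.pos_r
  have hT := h.pos_T
  have ht : 0 < -t := by linarith
  have hnR : (0 : ℝ) < n := by exact_mod_cast hn
  set B := Matrix.toEuclideanCLM (𝕜 := ℝ) V⁻¹ with hB
  set P := tiltedSection u x₀ y₀ e q r b ε σ t with hPdef
  set G := 7 / 24 * ε / (-t * (θ * b)) with hG
  have hG0 : 0 < G := by positivity
  have hGt : -t * G * (θ * b) = 7 / 24 * ε := by
    have htne : t ≠ 0 := ht0.ne
    rw [hG]
    field_simp
  set c₁ := -⟪e, x₀⟫ + θ * b with hc₁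
  set φ : E n → ℝ → ℝ := fun x τ => ε / (24 * n) * ‖B x - B a‖ ^ 2
      + ε / (96 * (θ * b) ^ 2) * (⟪e, x⟫ + c₁) ^ 2
      + (⟪σ • q - (t * G) • e, x⟫ + (-σ * ⟪q, y₀⟫ - 5 / 24 * ε - t * G * c₁))
      + τ * (⟪G • e, x⟫ + G * c₁) with hφdef
  have hφ : ∀ x τ, φ x τ = ε / (24 * n) * ‖B x - B a‖ ^ 2
      + ε / (96 * (θ * b) ^ 2) * (⟪e, x⟫ + c₁) ^ 2
      + (⟪σ • q - (t * G) • e, x⟫ + (-σ * ⟪q, y₀⟫ - 5 / 24 * ε - t * G * c₁))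
      + τ * (⟪G • e, x⟫ + G * c₁) := fun _ _ => rfl
  have hφ' : ∀ x τ, φ x τ = ε / 24 * (‖B (x - a)‖ ^ 2 / n)
      + ε / 96 * ((⟪e, x - x₀⟫ + θ * b) / (θ * b)) ^ 2 + σ * ⟪q, x - y₀⟫ - 5 / 24 * ε
      + G * (τ - t) * (⟪e, x - x₀⟫ + θ * b) := by
    intro x τ
    rw [hφ, map_sub]
    simp only [inner_sub_left, inner_sub_right, real_inner_smul_left, hc₁]
    field_simp
    ring
  set K := P ∩ {x | -(θ * b) ≤ ⟪e, x - x₀⟫} with hKdef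
  have hPc : IsCompact P := h.isCompact_tiltedSection ⟨htT, ht0.le⟩ q ε σ
  have hK : IsCompact K := hPc.inter_right (isClosed_le continuous_const (by fun_prop))
  have hKΩ : K ⊆ Ω := fun x hx => h.ball_subset hx.1.1
  have hx₀K : x₀ ∈ K := ⟨hx₀, by
    change -(θ * b) ≤ ⟪e, x₀ - x₀⟫
    rw [sub_self, inner_zero_right]
    have := mul_pos hθ hb
    linarith⟩
  have hθb := mul_pos hθ hb
  have hφc : Continuous (fun z : E n × ℝ => φ z.1 z.2) := by
    simp only [hφ']
    fun_prop
  set f := V.transpose.mulVec e.ofLp with hf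
  have hdet : ∀ x τ, (hessMatrix φ x τ).det = (ε / (12 * n)) ^ n * V.det⁻¹ ^ 2 *
      (1 + n / (4 * (θ * b) ^ 2) * dotProduct f f) := by
    intro x τ
    rw [hessMatrix_quad' hφ, det_quad V hV _ _ (by positivity), ← hf,
      show 2 * (ε / (24 * n)) = ε / (12 * n) by ring,
      show 2 * (ε / (96 * (θ * b) ^ 2)) / (ε / (12 * n)) = n / (4 * (θ * b) ^ 2) by
        field_simp
        norm_num]
  have hff : b ^ 2 / (16 * n) ≤ dotProduct f f :=
    dotProduct_lower_bound hn hV h.inner_y (hVP x₀ hx₀) (hVP y₀ hy₀)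
  have hmain := h.sol.2.2.le_of_strict (t₁ := t) (t₂ := 0) (φ := φ) h.sol.1.cont hK hKΩ htT le_rfl
    hφc (isTestAt_quad hφ) ?_ ?_ ?_ x₀ hx₀K 0 ⟨ht0.le, le_rfl⟩
  · rw [h.zero_x, hφ', sub_self, inner_zero_right, zero_add, div_self hθb.ne'] at hmain
    have h1 : 0 ≤ ε / 24 * (‖B (x₀ - a)‖ ^ 2 / n) := by positivity
    have h2 : G * (0 - t) * (θ * b) = 7 / 24 * ε := by rw [← hGt]; ring
    have h3 : -(ε / 24) ≤ σ * ⟪q, x₀ - y₀⟫ := by nlinarith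
    linarith
  · rintro x ⟨hxP, hxe : -(θ * b) ≤ ⟪e, x - x₀⟫⟩ τ hτ hor
    have hxΩ := h.ball_subset hxP.1
    obtain ⟨hx1, hx2⟩ := hP x hxP
    have hψ : ‖B (x - a)‖ ^ 2 / n ≤ 1 := by rw [div_le_one hnR]; exact hVP x hxP
    have hmono : u x t ≤ u x τ := h.sol.1.mono x (subset_closure hxΩ) t ⟨htT, ht0.le⟩ τ
      ⟨htT.trans hτ.1, hτ.2⟩ hτ.1
    have hl := hlow x hxP
    have hψ' := mul_le_mul_of_nonneg_left hψ (show 0 ≤ ε / 24 by positivity)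
    rw [hφ']
    by_cases hz : ⟪e, x - x₀⟫ = -(θ * b)
    · rw [hz, neg_add_cancel, zero_div, mul_zero]
      linarith
    set ζ := (⟪e, x - x₀⟫ + θ * b) / (θ * b) with hζ
    have hζ0 : 0 ≤ ζ := div_nonneg (by linarith) hθb.le
    have hζ2 : ζ ≤ 2 := by rw [hζ, div_le_iff₀ hθb]; linarith
    have hζs : ε / 96 * ζ ^ 2 ≤ ε / 96 * 4 := by
      apply mul_le_mul_of_nonneg_left _ (by positivity)
      nlinarith
    by_cases hτt : τ = t
    · subst hτt
      rw [sub_self, mul_zero, zero_mul]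
      linarith
    have hor' := hor.resolve_left hτt
    have hL : σ * ⟪q, x - y₀⟫ + ε * ((⟪e, x - x₀⟫ + b) / b) ≤ u x t := by
      by_contra hlt
      push Not at hlt
      apply hor'
      have hc := (h.continuousOn_slice ⟨htT, ht0.le⟩).continuousAt (h.isOpen.mem_nhds hxΩ)
      have e1 : ∀ᶠ x' in nhds x, u x' t <
          σ * ⟪q, x' - y₀⟫ + ε * ((⟪e, x' - x₀⟫ + b) / b) :=
        hc.eventually_lt (Continuous.continuousAt (by fun_prop)) hlt
      have e2 : ∀ᶠ x' in nhds x, -(θ * b) < ⟪e, x' - x₀⟫ :=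
        ContinuousAt.eventually_lt (by fun_prop) (Continuous.continuousAt (by fun_prop))
          (lt_of_le_of_ne hxe (Ne.symm hz))
      have e3 : ∀ᶠ x' in nhds x, x' ∈ ball x₀ r :=
        isOpen_ball.mem_nhds (by rw [mem_ball_iff_norm]; linarith)
      filter_upwards [e1, e2, e3] with x' h1 h2 h3
      exact ⟨⟨ball_subset_closedBall h3, by nlinarith, h1.le⟩, h2.le⟩
    have hg : 1 / 2 ≤ (⟪e, x - x₀⟫ + b) / b := by
      rw [le_div_iff₀ hb]; nlinarith
    have hg' := mul_le_mul_of_nonneg_left hg hε.le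
    have hlast : G * (τ - t) * (⟪e, x - x₀⟫ + θ * b) ≤ 7 / 24 * ε * 2 := by
      have h1 : ⟪e, x - x₀⟫ + θ * b = ζ * (θ * b) := by rw [hζ]; field_simp
      have h2 : (τ - t) * ζ ≤ -t * 2 := by
        have := hτ.2
        have := hτ.1
        exact mul_le_mul (by linarith) hζ2 hζ0 ht.le
      rw [h1, ← hGt]
      have := mul_le_mul_of_nonneg_left h2 (mul_pos hG0 hθb).le
      linarith
    linarith
  · intro x τ
    rw [hessMatrix_quad' hφ]
    exact posSemidef_quad _ _ (by positivity) (by positivity)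
  · rintro x ⟨hxP, hxe : -(θ * b) ≤ ⟪e, x - x₀⟫⟩ τ
    obtain ⟨hx1, hx2⟩ := hP x hxP
    rw [timeDeriv_quad hφ, hdet, real_inner_smul_left]
    have h1 : G * ⟪e, x⟫ + G * c₁ = G * (⟪e, x - x₀⟫ + θ * b) := by
      rw [hc₁, inner_sub_right]; ring
    have h2 : -t * (G * (⟪e, x - x₀⟫ + θ * b)) ≤ 7 / 12 * ε := by
      have : G * (⟪e, x - x₀⟫ + θ * b) ≤ G * (2 * (θ * b)) :=
        mul_le_mul_of_nonneg_left (by linarith) hG0.le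
      have := mul_le_mul_of_nonneg_left this ht.le
      linarith
    have h3 : (1 / (12 * n)) ^ n / (64 * θ ^ 2) * (ε ^ n * V.det⁻¹ ^ 2) ≤
        (ε / (12 * n)) ^ n * V.det⁻¹ ^ 2 * (1 + n / (4 * (θ * b) ^ 2) * dotProduct f f) := by
      have e1 : (1 / (12 * n)) ^ n / (64 * θ ^ 2) * (ε ^ n * V.det⁻¹ ^ 2) =
          (ε / (12 * n)) ^ n * V.det⁻¹ ^ 2 * (n / (4 * (θ * b) ^ 2) * (b ^ 2 / (16 * n))) := by
        rw [div_pow, div_pow, one_pow]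
        field_simp
        norm_num
      rw [e1]
      apply mul_le_mul_of_nonneg_left _ (by positivity)
      have := mul_le_mul_of_nonneg_left hff (show 0 ≤ n / (4 * (θ * b) ^ 2) by positivity)
      linarith
    have h4 := Real.rpow_le_rpow (by positivity) h3 h.pos_p.le
    have h5 := mul_le_mul_of_nonneg_left h4 h.pos_lam.le
    rw [h1]
    refine lt_of_lt_of_le ?_ h5
    refine lt_of_mul_lt_mul_left ?_ ht.le
    linarith

lemma TouchingConfig.mono_le {lam Lam p T : ℝ} {Ω : Set (E n)} {u : E n → ℝ → ℝ}
    {x₀ y₀ e : E n} {r b : ℝ} (h : TouchingConfig lam Lam p T Ω u x₀ y₀ e r b) {x : E n}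
    (hx : x ∈ Ω) {s t : ℝ} (hs : -T ≤ s) (hst : s ≤ t) (ht : t ≤ 0) : u x s ≤ u x t :=
  h.sol.1.mono x (subset_closure hx) s ⟨hs, hst.trans ht⟩ t ⟨hs.trans hst, ht⟩ hst

lemma TouchingConfig.nonpos_mid {lam Lam p T : ℝ} {Ω : Set (E n)} {u : E n → ℝ → ℝ}
    {x₀ y₀ e : E n} {r b : ℝ} (h : TouchingConfig lam Lam p T Ω u x₀ y₀ e r b) {t : ℝ}
    (ht : t ∈ Icc (-T) 0) : u y₀ t ≤ 0 := by
  have hT := h.pos_T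
  have hx₀ : x₀ ∈ Ω := h.ball_subset (mem_closedBall_self h.pos_r.le)
  have hy₀ : y₀ ∈ Ω := h.ball_subset (mem_closedBall_iff_norm.2 h.norm_y.le)
  have h1 := (h.sol.1.conv 0 ⟨by linarith, le_rfl⟩).2 (subset_closure hx₀)
    (subset_closure h.mem_y) (show (0 : ℝ) ≤ 1 / 2 by norm_num)
    (show (0 : ℝ) ≤ 1 / 2 by norm_num) (by norm_num)
  have h2 : (1 / 2 : ℝ) • x₀ + (1 / 2 : ℝ) • (y₀ + (y₀ - x₀)) = y₀ := by module
  simp only [h2, h.zero_x, h.zero_y, smul_zero, add_zero] at h1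
  exact (h.mono_le hy₀ ht.1 ht.2 le_rfl).trans h1

/-- One step of the iteration: the volume of a section controls the elapsed time from below and
the remaining time from above. -/
lemma TouchingConfig.step {lam Lam p T : ℝ} {Ω : Set (E n)} {u : E n → ℝ → ℝ}
    {x₀ y₀ e : E n} {r b : ℝ} (h : TouchingConfig lam Lam p T Ω u x₀ y₀ e r b)
    {θ M t t' t'' ε : ℝ} {q : E n} (hn : 0 < n) (hθ : 0 < θ) (hθ1 : θ ≤ 1 / 2) (hM : 0 < M)
    (htT : -T ≤ t) (htt : t < t') (htt' : t' ≤ t'') (ht0 : t'' < 0) (hε : 0 < ε)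
    (hsup : ∀ x ∈ Ω, -(ε / 24) + ⟪q, x - y₀⟫ ≤ u x t') (hεM : ε * M ≤ 1 / 2)
    (hsec : ∀ x ∈ closedBall x₀ r, -b ≤ ⟪e, x - x₀⟫ →
        u x t'' ≤ (1 - ε * M) * ⟪q, x - y₀⟫ + ε * ((⟪e, x - x₀⟫ + b) / b) →
        ⟪e, x - x₀⟫ ≤ θ * b ∧ ‖x - x₀‖ < r / 2 ∧ -(1 / 24) ≤ M * ⟪q, x - y₀⟫)
    (hut : u y₀ t ≤ -(12 * ε)) :
    ∃ Y > (0 : ℝ), -t'' * (lam * ((1 / (12 * n)) ^ n / (64 * θ ^ 2) * Y) ^ p) ≤ ε ∧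
      25 / 8 * ε ≤ (t' - t) * (Lam * ((25 / (1 / (2 * (n * (n + 1)))) ^ 2) ^ n * Y) ^ p) := by
  have hb := h.pos_b
  have hr := h.pos_r
  have hnR : (0 : ℝ) < n := by exact_mod_cast hn
  have hx₀ : x₀ ∈ Ω := h.ball_subset (mem_closedBall_self hr.le)
  have hy₀ : y₀ ∈ Ω := h.ball_subset (mem_closedBall_iff_norm.2 h.norm_y.le)
  have hε1 : 0 < ε * M := by positivity
  have htT'' : t'' ∈ Icc (-T) 0 := ⟨by linarith, ht0.le⟩
  set σ := 1 - ε * M with hσ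
  have hσ0 : 0 ≤ σ := by linarith
  have hσ1 : σ ≤ 1 := by linarith
  set P := tiltedSection u x₀ y₀ e q r b ε σ t'' with hP
  have hPsub : P ⊆ Ω := fun x hx => h.ball_subset hx.1
  have hq1 : ⟪q, x₀ - y₀⟫ ≤ ε / 24 := by
    have h1 := hsup x₀ hx₀
    have h2 := h.mono_le hx₀ (by linarith : -T ≤ t') (by linarith) le_rfl
    rw [h.zero_x] at h2
    linarith
  have hq2 : -(ε / 24) ≤ ⟪q, x₀ - y₀⟫ := by
    have h1 := hsup _ h.mem_y
    have h2 := h.mono_le h.mem_y (by linarith : -T ≤ t') (by linarith) le_rfl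
    rw [h.zero_y] at h2
    have e0 : y₀ + (y₀ - x₀) - y₀ = -(x₀ - y₀) := by abel
    rw [e0, inner_neg_right] at h1
    linarith
  have hx₀P : x₀ ∈ P := by
    refine mem_tiltedSection.2 ⟨mem_closedBall_self hr.le, ?_, ?_⟩
    · rw [sub_self, inner_zero_right]; linarith
    · rw [sub_self, inner_zero_right, zero_add, div_self hb.ne']
      have h2 := h.mono_le hx₀ htT''.1 htT''.2 le_rfl
      rw [h.zero_x] at h2
      nlinarith
  have hg0 : (⟪e, y₀ - x₀⟫ + b) / b = 1 / 2 := by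
    rw [h.inner_y]; field_simp; norm_num
  have hy₀int : y₀ ∈ interior P := by
    rw [mem_interior_iff_mem_nhds]
    have hc := (h.continuousOn_slice htT'').continuousAt (h.isOpen.mem_nhds hy₀)
    have e1 : ∀ᶠ x' in nhds y₀, u x' t'' <
        σ * ⟪q, x' - y₀⟫ + ε * ((⟪e, x' - x₀⟫ + b) / b) := by
      refine hc.eventually_lt (Continuous.continuousAt (by fun_prop)) ?_
      rw [sub_self, inner_zero_right, hg0]
      have := h.nonpos_mid htT''
      linarith
    have e2 : ∀ᶠ x' in nhds y₀, -b < ⟪e, x' - x₀⟫ :=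
      ContinuousAt.eventually_lt (by fun_prop) (Continuous.continuousAt (by fun_prop))
        (by rw [h.inner_y]; linarith)
    have e3 : ∀ᶠ x' in nhds y₀, x' ∈ ball x₀ r :=
      isOpen_ball.mem_nhds (mem_ball_iff_norm.2 h.norm_y)
    filter_upwards [e1, e2, e3] with x' h1 h2 h3
    exact ⟨ball_subset_closedBall h3, h2.le, h1.le⟩
  have hy₀P : y₀ ∈ P := interior_subset hy₀int
  have hsecP : ∀ x ∈ P, ⟪e, x - x₀⟫ ≤ θ * b ∧ ‖x - x₀‖ < r / 2 ∧ -(1 / 24) ≤ M * ⟪q, x - y₀⟫ :=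
    fun x hx => hsec x hx.1 hx.2.1 hx.2.2
  have hlow : ∀ x ∈ P, σ * ⟪q, x - y₀⟫ - ε / 12 ≤ u x t' := by
    intro x hx
    have h1 := hsup x (hPsub hx)
    have h2 := mul_le_mul_of_nonneg_left (hsecP x hx).2.2 hε.le
    rw [hσ]
    linarith
  have hPv : Convex ℝ P := h.convex_tiltedSection htT'' q ε σ
  obtain ⟨V, a, c, hV, hVP, hVc⟩ :=
    exists_simplex_position (h.isCompact_tiltedSection htT'' q ε σ) hPv hy₀int
  refine ⟨ε ^ n * V.det⁻¹ ^ 2, by positivity, ?_, ?_⟩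
  · exact h.lower_barrier hn hθ hθ1 htT''.1 ht0 hε hσ0 hσ1
      (fun x hx => ⟨(hsecP x hx).1, (hsecP x hx).2.1⟩)
      (fun x hx => (hlow x hx).trans (h.mono_le (hPsub hx) (by linarith) htt' ht0.le))
      hV hVP hx₀P hy₀P hq2
  · by_contra hcon
    push Not at hcon
    set A := Matrix.toEuclideanCLM (𝕜 := ℝ) V with hA
    set ρ : ℝ := 1 / (2 * (n * (n + 1))) with hρ
    have hρ0 : 0 < ρ := by positivity
    set c₀ := -σ * ⟪q, y₀⟫ + ε / b * (-⟪e, x₀⟫ + b) with hc₀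
    have hL : ∀ x, σ * ⟪q, x - y₀⟫ + ε * ((⟪e, x - x₀⟫ + b) / b) =
        ⟪σ • q + (ε / b) • e, x⟫ + c₀ := by
      intro x
      simp only [inner_add_left, inner_sub_right, real_inner_smul_left, hc₀]
      ring
    set v := σ • q + (ε / b) • e with hv
    have hPL : ∀ x ∈ P, u x t'' ≤ ⟪v, x⟫ + c₀ := fun x hx => by
      rw [← hL]; exact hx.2.2
    have hLy : ⟪v, y₀⟫ + c₀ = ε / 2 := by
      rw [← hL, sub_self, inner_zero_right, hg0]; ring
    set z := (1 / 2 : ℝ) • (y₀ + c) with hz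
    have hmid : ∀ μ : E n, z + A μ = (1 / 2 : ℝ) • y₀ + (1 / 2 : ℝ) • (c + A ((2 : ℝ) • μ)) := by
      intro μ
      rw [map_smul, hz]
      module
    have hw : ∀ μ : E n, ‖μ‖ ≤ ρ → c + A ((2 : ℝ) • μ) ∈ P := by
      intro μ hμ
      apply hVc
      rw [norm_smul, Real.norm_of_nonneg (by norm_num)]
      calc 2 * ‖μ‖ ≤ 2 * ρ := by linarith
        _ = 1 / (n * (n + 1)) := by rw [hρ]; field_simp
    have hzP : ∀ μ : E n, ‖μ‖ ≤ ρ → z + A μ ∈ P := by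
      intro μ hμ
      rw [hmid]
      exact hPv hy₀P (hw μ hμ) (by norm_num) (by norm_num) (by norm_num)
    have hz0 : z ∈ P := by
      have := hzP 0 (by rw [norm_zero]; exact hρ0.le)
      rwa [map_zero, add_zero] at this
    have hmain := h.sol.2.1.le_sub_half (d := 25 / 4 * ε) (v := v) (c := c₀) h.sol.1.cont hV hρ0
      (by positivity) htT htt (by linarith) (fun μ hμ => hPsub (hzP μ hμ)) ?_ ?_ ?_
    · rw [← hL] at hmain
      have h1 := hlow z hz0
      have h2 := (hsecP z hz0).1
      have h3 : (⟪e, z - x₀⟫ + b) / b ≤ 3 / 2 := by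
        rw [div_le_iff₀ hb]; nlinarith
      have h4 := mul_le_mul_of_nonneg_left h3 hε.le
      linarith
    · rintro x hx μ hμ rfl τ hτ
      exact (h.mono_le hx (htT.trans hτ.1) (hτ.2.trans htt') ht0.le).trans (hPL _ (hzP μ hμ))
    · rintro x hx μ hμ hxμ
      rw [hmid] at hxμ
      have hwP := hw μ hμ
      set w := c + A ((2 : ℝ) • μ) with hwdef
      have h1 := (h.sol.1.conv t ⟨htT, by linarith⟩).2 (subset_closure hy₀)
        (subset_closure (hPsub hwP)) (show (0 : ℝ) ≤ 1 / 2 by norm_num)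
        (show (0 : ℝ) ≤ 1 / 2 by norm_num) (by norm_num)
      simp only [← hxμ, smul_eq_mul] at h1
      have h2 := (h.mono_le (hPsub hwP) htT (by linarith) ht0.le).trans (hPL w hwP)
      have h3 : ⟪v, x⟫ = 1 / 2 * ⟪v, y₀⟫ + 1 / 2 * ⟪v, w⟫ := by
        rw [hxμ, inner_add_right, inner_smul_right, inner_smul_right]
      linarith
    · have e1 : (4 * (25 / 4 * ε) / ρ ^ 2) ^ n * V.det⁻¹ ^ 2 =
          (25 / ρ ^ 2) ^ n * (ε ^ n * V.det⁻¹ ^ 2) := by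
        have e0 : 4 * (25 / 4 * ε) / ρ ^ 2 = 25 / ρ ^ 2 * ε := by ring
        rw [e0, mul_pow]
        ring
      rw [e1]
      linarith

/-- The value at the midpoint cannot recover from being negative too quickly. -/
lemma TouchingConfig.time_lower_bound {lam Lam p T : ℝ} {Ω : Set (E n)} {u : E n → ℝ → ℝ}
    {x₀ y₀ e : E n} {r b : ℝ} (h : TouchingConfig lam Lam p T Ω u x₀ y₀ e r b) :
    ∃ c > (0 : ℝ), ∀ t, -T ≤ t → t < 0 → u y₀ t < 0 →
      c * (-u y₀ t * ((-u y₀ t) ^ n) ^ p) ≤ -t := by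
  have hT := h.pos_T
  have hp := h.pos_p
  have hLam := h.pos_Lam
  have hy₀ : y₀ ∈ Ω := h.ball_subset (mem_closedBall_iff_norm.2 h.norm_y.le)
  obtain ⟨R, hR, hRΩ⟩ := Metric.nhds_basis_closedBall.mem_iff.1 (h.isOpen.mem_nhds hy₀)
  obtain ⟨U₀, hU₀⟩ := (isCompact_closedBall y₀ R).bddAbove_image
    ((h.continuousOn_slice (t := 0) ⟨by linarith, le_rfl⟩).mono hRΩ)
  set U := max U₀ 1 with hU
  have hU1 : 0 < U := by positivity
  have hUb : ∀ x ∈ closedBall y₀ R, u x 0 ≤ U := fun x hx =>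
    (hU₀ (mem_image_of_mem _ hx)).trans (le_max_left _ _)
  have hs₀ : 0 ≤ -u y₀ (-T) := by
    have := h.nonpos_mid (t := -T) ⟨le_rfl, by linarith⟩
    linarith
  set k := 1 / (4 * (U + -u y₀ (-T))) with hk
  have hk0 : 0 < k := by positivity
  have hkU : k * (U + -u y₀ (-T)) = 1 / 4 := by rw [hk]; field_simp
  refine ⟨1 / (2 * (Lam * ((4 / (k * R) ^ 2) ^ n) ^ p)), by positivity, fun t ht ht0 hut => ?_⟩
  set S := -u y₀ t with hS
  have hS0 : 0 < S := by linarith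
  have hSs : S ≤ -u y₀ (-T) := by
    have := h.mono_le hy₀ le_rfl ht ht0.le
    linarith
  have hkS : k * (U + S) ≤ 1 / 4 := by rw [← hkU]; gcongr
  have hκ1 : k * S ≤ 1 := by nlinarith
  have hbd : ∀ μ : E n, ‖μ‖ ≤ k * S * R → ∀ τ ∈ Icc (-T) 0, y₀ + μ ∈ Ω ∧
      u (y₀ + μ) τ ≤ (1 - k * S) * u y₀ τ + k * S * U := by
    intro μ hμ τ hτ
    have hw : y₀ + (k * S)⁻¹ • μ ∈ closedBall y₀ R := by
      rw [mem_closedBall_iff_norm, add_sub_cancel_left, norm_smul, norm_inv,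
        Real.norm_of_nonneg (by positivity), inv_mul_le_iff₀ (by positivity)]
      exact hμ
    have h1 := (h.sol.1.conv τ hτ).2 (subset_closure hy₀) (subset_closure (hRΩ hw))
      (show 0 ≤ 1 - k * S by linarith) (show 0 ≤ k * S by positivity) (by ring)
    have h2 : (1 - k * S) • y₀ + (k * S) • (y₀ + (k * S)⁻¹ • μ) = y₀ + μ := by
      rw [smul_add, smul_inv_smul₀ (by positivity)]
      module
    simp only [h2, smul_eq_mul] at h1
    refine ⟨hRΩ ?_, h1.trans ?_⟩
    · rw [mem_closedBall_iff_norm, add_sub_cancel_left]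
      refine hμ.trans ?_
      nlinarith
    · have h3 := (h.mono_le (hRΩ hw) hτ.1 hτ.2 le_rfl).trans (hUb _ hw)
      have := mul_le_mul_of_nonneg_left h3 (show 0 ≤ k * S by positivity)
      linarith
  by_contra hcon
  push Not at hcon
  have hA : ∀ μ : E n, y₀ + Matrix.toEuclideanCLM (𝕜 := ℝ) (1 : Matrix (Fin n) (Fin n) ℝ) μ
      = y₀ + μ := by
    intro μ
    rw [map_one]
    rfl
  have hmain := h.sol.2.1.le_sub_half (V := 1) (z := y₀) (d := S) (v := 0) (c := S / 4)
    (ρ := k * S * R) (t := t) (t₁ := 0) h.sol.1.cont (by simp) (by positivity) hS0 ht ht0 le_rfl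
    ?_ ?_ ?_ ?_
  · rw [inner_zero_left] at hmain
    have := h.nonneg y₀ hy₀
    linarith
  · intro μ hμ
    rw [hA]
    exact (hbd μ hμ 0 ⟨by linarith, le_rfl⟩).1
  · rintro x - μ hμ rfl τ hτ
    rw [hA, inner_zero_left]
    have hτ' : τ ∈ Icc (-T) 0 := ⟨ht.trans hτ.1, hτ.2⟩
    have h1 := (hbd μ hμ τ hτ').2
    have h2 := h.nonpos_mid hτ'
    have h3 : k * U ≤ 1 / 4 := by nlinarith
    have h4 := mul_le_mul_of_nonneg_right h3 hS0.le
    have h5 := mul_nonneg_of_nonpos_of_nonpos (show -(1 - k * S) ≤ 0 by linarith) h2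
    linarith
  · rintro x - μ hμ rfl
    rw [hA, inner_zero_left]
    have h1 := (hbd μ hμ t ⟨ht, ht0.le⟩).2
    have h4 := mul_le_mul_of_nonneg_right hkS hS0.le
    have h5 : u y₀ t = -S := by rw [hS]; ring
    rw [h5] at h1
    linarith
  · have e1 : ((4 * S / (k * S * R) ^ 2) ^ n * (1 : Matrix (Fin n) (Fin n) ℝ).det⁻¹ ^ 2) ^ p =
        ((4 / (k * R) ^ 2) ^ n) ^ p / (S ^ n) ^ p := by
      rw [← Real.div_rpow (by positivity) (by positivity), ← div_pow]
      simp only [Matrix.det_one, inv_one, one_pow, mul_one]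
      congr 2
      field_simp
    rw [e1, zero_sub]
    rw [one_div, inv_mul_eq_div, lt_div_iff₀ (by positivity)] at hcon
    rw [← mul_div_assoc, ← mul_div_assoc, div_lt_iff₀ (by positivity)]
    linarith

/-- A positive sequence bounded below by a geometric one cannot contract much faster. -/
lemma not_contracting_of_geometric_lower_bound {a : ℕ → ℝ} {c m γ : ℝ} {k₀ : ℕ} (hc : 0 < c)
    (hm : 0 < m) (hγ : 0 < γ) (ha : ∀ k, c / γ ^ k ≤ a k)
    (h : ∀ k, k₀ ≤ k → 2 * γ * min (a (k + 1)) m ≤ a k - a (k + 1)) : False := by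
  have hpos : ∀ k, 0 < a k := fun k => lt_of_lt_of_le (by positivity) (ha k)
  have hanti : ∀ k, k₀ ≤ k → a (k + 1) ≤ a k := by
    intro k hk
    have h1 := h k hk
    have h2 : 0 < 2 * γ * min (a (k + 1)) m :=
      mul_pos (by positivity) (lt_min (hpos _) hm)
    linarith
  obtain ⟨k₁, hk₁, hak₁⟩ : ∃ k₁, k₀ ≤ k₁ ∧ a k₁ ≤ m := by
    by_contra! hcon
    have hlin : ∀ j : ℕ, a (k₀ + j) ≤ a k₀ - j * (2 * γ * m) := by
      intro j
      induction j with
      | zero => simp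
      | succ j ih =>
        have h1 := h (k₀ + j) (by omega)
        rw [min_eq_right (hcon _ (by omega)).le] at h1
        push_cast
        rw [← add_assoc]
        linarith
    obtain ⟨j, hj⟩ := exists_nat_gt (a k₀ / (2 * γ * m))
    rw [div_lt_iff₀ (by positivity)] at hj
    linarith [hlin j, hpos (k₀ + j)]
  have hgeo : ∀ j : ℕ, a (k₁ + j) ≤ m ∧ a (k₁ + j) * (2 * γ) ^ j ≤ m := by
    intro j
    induction j with
    | zero => simpa using hak₁
    | succ j ih =>
      rw [← add_assoc]
      have h0 := hanti (k₁ + j) (by omega)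
      have h1 := h (k₁ + j) (by omega)
      rw [min_eq_left (h0.trans ih.1)] at h1
      refine ⟨h0.trans ih.1, le_trans ?_ ih.2⟩
      have h2 : 2 * γ * a (k₁ + j + 1) ≤ a (k₁ + j) := by linarith [hpos (k₁ + j + 1)]
      have h3 := mul_le_mul_of_nonneg_right h2 (show 0 ≤ (2 * γ) ^ j by positivity)
      rw [pow_succ]
      linarith
  obtain ⟨j, hj⟩ := pow_unbounded_of_one_lt (m * γ ^ k₁ / c) (one_lt_two (α := ℝ))
  have h1 := (hgeo j).2
  have h2 := mul_le_mul_of_nonneg_right (ha (k₁ + j)) (show 0 ≤ (2 * γ) ^ j by positivity)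
  have h3 : c / γ ^ (k₁ + j) * (2 * γ) ^ j = c / γ ^ k₁ * 2 ^ j := by
    rw [mul_pow, pow_add]
    field_simp
  rw [div_lt_iff₀ hc] at hj
  have h4 : c / γ ^ k₁ * 2 ^ j ≤ m := by linarith
  rw [div_mul_eq_mul_div, div_le_iff₀ (by positivity)] at h4
  linarith

/-- Time steps dominate the remaining time when the slab is thin. -/
lemma exists_thin_slab {lam p A a : ℝ} (hlam : 0 < lam) (hp : 0 < p) (ha : 0 < a) :
    ∃ θ > (0 : ℝ), θ ≤ 1 / 2 ∧ A ≤ lam * (a / (64 * θ ^ 2)) ^ p := by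
  obtain ⟨W, hW, hW0⟩ := (((tendsto_rpow_atTop hp).eventually_ge_atTop (A / lam)).and
    (Filter.eventually_gt_atTop 0)).exists
  rw [div_le_iff₀' hlam] at hW
  set θ := min (1 / 2) (a / (64 * W)) with hθ
  have hθ0 : 0 < θ := by positivity
  refine ⟨θ, hθ0, min_le_left _ _, hW.trans ?_⟩
  have h1 : θ ≤ 1 / 2 := min_le_left _ _
  have h2 : θ ≤ a / (64 * W) := min_le_right _ _
  rw [le_div_iff₀ (by positivity)] at h2
  gcongr
  rw [le_div_iff₀ (by positivity)]
  nlinarith [mul_pos hθ0 hW0]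

/-- In a touching configuration the solution is not negative at the midpoint initially. -/
lemma TouchingConfig.not_neg {lam Lam p T : ℝ} {Ω : Set (E n)} {u : E n → ℝ → ℝ}
    {x₀ y₀ e : E n} {r b : ℝ} (h : TouchingConfig lam Lam p T Ω u x₀ y₀ e r b)
    (hneg : u y₀ (-T) < 0) : False := by
  have hT := h.pos_T
  have hp := h.pos_p
  have hlam := h.pos_lam
  have hLam := h.pos_Lam
  have hr := h.pos_r
  have hn : 0 < n := by
    rcases Nat.eq_zero_or_pos n with rfl | hn
    · have h1 := h.inner_y
      rw [Subsingleton.elim e 0, inner_zero_left] at h1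
      linarith [h.pos_b]
    · exact hn
  have hnR : (0 : ℝ) < n := by exact_mod_cast hn
  have hy₀ : y₀ ∈ Ω := h.ball_subset (mem_closedBall_iff_norm.2 h.norm_y.le)
  have hy0 : u y₀ 0 = 0 :=
    le_antisymm (h.nonpos_mid ⟨by linarith, le_rfl⟩) (h.nonneg y₀ hy₀)
  set γ : ℝ := 288 * (288 ^ n) ^ p with hγ
  have hγ0 : 0 < γ := by positivity
  set c₂ := Lam * ((25 / (1 / (2 * (n * (n + 1 : ℝ)))) ^ 2) ^ n) ^ p with hc₂
  have hc₂0 : 0 < c₂ := by positivity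
  obtain ⟨θ, hθ, hθ1, hθ2⟩ := exists_thin_slab (A := 2 * γ * c₂) (a := (1 / (12 * n : ℝ)) ^ n)
    hlam hp (by positivity)
  obtain ⟨M, hM, t₀, ht₀, ht₀T, ε₀, hε₀, hsec⟩ := h.section_bound hθ
  obtain ⟨c, hc, htime⟩ := h.time_lower_bound
  set S := -u y₀ (-T) with hS
  have hS0 : 0 < S := by linarith
  have hcont : ContinuousOn (fun t => u y₀ t) (Icc (-T) 0) :=
    h.sol.1.cont.comp (f := fun t => (y₀, t)) (by fun_prop)
      (fun t ht => ⟨subset_closure hy₀, ht⟩)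
  have hivt : ∀ k : ℕ, ∃ t ∈ Icc (-T) 0, u y₀ t = -(S / 288 ^ k) := by
    intro k
    have h1 := intermediate_value_Icc (by linarith : -T ≤ 0) hcont
    have h2 : S / 288 ^ k ≤ S := div_le_self hS0.le (one_le_pow₀ (by norm_num))
    have h3 : 0 < S / 288 ^ k := by positivity
    exact h1 ⟨by linarith, by rw [hy0]; linarith⟩
  choose τ hτ huτ using hivt
  have hτ0 : ∀ k, τ k < 0 := by
    intro k
    refine lt_of_le_of_ne (hτ k).2 fun h0 => ?_
    have h1 := huτ k
    have h3 : 0 < S / 288 ^ k := by positivity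
    rw [h0, hy0] at h1
    linarith
  have hstep : ∀ k, S / 288 ^ k = 288 * (S / 288 ^ (k + 1)) := by
    intro k
    rw [pow_succ]
    field_simp
  have hττ : ∀ k, τ k < τ (k + 1) := by
    intro k
    by_contra! hle
    have h1 := h.mono_le hy₀ (hτ (k + 1)).1 hle (hτ k).2
    rw [huτ, huτ, hstep k] at h1
    have h3 : 0 < S / 288 ^ (k + 1) := by positivity
    linarith
  obtain ⟨k₀, hk₀⟩ := pow_unbounded_of_one_lt (24 * S / ε₀) (show (1 : ℝ) < 288 by norm_num)
  refine not_contracting_of_geometric_lower_bound (a := fun k => -τ k)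
    (c := c * (S * (S ^ n) ^ p)) (m := -t₀) (k₀ := k₀) (by positivity) (by linarith) hγ0 ?_ ?_
  · intro k
    have h3 : 0 < S / 288 ^ k := by positivity
    have h1 := htime (τ k) (hτ k).1 (hτ0 k) (by rw [huτ]; linarith)
    rw [huτ, neg_neg] at h1
    refine le_trans (le_of_eq ?_) h1
    have e1 : γ ^ k = 288 ^ k * ((288 ^ k) ^ n) ^ p := by
      rw [hγ, mul_pow, ← Real.rpow_natCast ((288 ^ n : ℝ) ^ p) k, ← Real.rpow_mul (by positivity),
        mul_comm p, Real.rpow_mul (by positivity), Real.rpow_natCast, ← pow_mul, mul_comm n k,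
        pow_mul]
    rw [e1, div_pow, Real.div_rpow (by positivity) (by positivity)]
    field_simp
  · intro k hk
    set ε := 24 * (S / 288 ^ (k + 1)) with hε
    have hε0 : 0 < ε := by positivity
    have hεε₀ : ε ≤ ε₀ := by
      rw [div_lt_iff₀ hε₀] at hk₀
      have h1 : (288 : ℝ) ^ k₀ ≤ 288 ^ (k + 1) := pow_le_pow_right₀ (by norm_num) (by omega)
      rw [hε, ← mul_div_assoc, div_le_iff₀ (by positivity)]
      nlinarith
    set t'' := max (τ (k + 1)) t₀ with ht''
    have ht''0 : t'' < 0 := max_lt (hτ0 _) ht₀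
    obtain ⟨q, hq⟩ := ConvexOn.exists_subgradient h.isOpen
      ((h.sol.1.conv (τ (k + 1)) (hτ _)).subset subset_closure h.convex)
      (h.continuousOn_slice (hτ (k + 1))) hy₀
    have hsup : ∀ x ∈ Ω, -(ε / 24) + ⟪q, x - y₀⟫ ≤ u x (τ (k + 1)) := by
      intro x hx
      have h1 := hq x hx
      rw [huτ] at h1
      rw [hε]
      linarith
    obtain ⟨hεM, hsec'⟩ := hsec t'' ⟨le_max_right _ _, ht''0.le⟩ q (ε / 24) ε (by linarith) hε0
      hεε₀ (fun x hx => (hsup x (h.ball_subset hx)).trans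
        (h.mono_le (h.ball_subset hx) (hτ _).1 (le_max_left _ _) ht''0.le))
    obtain ⟨Y, hY, h1, h2⟩ := h.step hn hθ hθ1 hM (hτ k).1 (hττ k) (le_max_left _ _) ht''0 hε0
      hsup hεM hsec' (by rw [huτ, hstep k, hε]; linarith)
    rw [Real.mul_rpow (by positivity) hY.le, ← mul_assoc lam] at h1
    rw [Real.mul_rpow (by positivity) hY.le, ← mul_assoc Lam, ← hc₂] at h2
    have hX : 0 < Y ^ p := by positivity
    have h3 := mul_le_mul_of_nonneg_right hθ2 (mul_nonneg hX.le (neg_nonneg.2 ht''0.le))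
    have h4 : 2 * γ * -t'' * (c₂ * Y ^ p) ≤ (τ (k + 1) - τ k) * (c₂ * Y ^ p) := by linarith
    have h5 := le_of_mul_le_mul_right h4 (by positivity)
    rw [ht'', ← min_neg_neg] at h5
    linarith

/-- If a convex function is nonpositive and somewhere negative on a convex set, then from each point
of the set there is a nontrivial open segment in the set on which it is negative. -/
lemma exists_direction_neg {D : Set (E n)} {f : E n → ℝ} (hf : ConvexOn ℝ D f)
    (hle : ∀ x ∈ D, f x ≤ 0) {x₁ z : E n} (hx₁ : x₁ ∈ D) (hneg : f x₁ < 0) (hz : z ∈ D)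
    (hnt : ∃ w ∈ D, w ≠ z) :
    ∃ y ∈ D, y ≠ z ∧ ∀ s : ℝ, 0 < s → s < 1 → f (z + s • (y - z)) < 0 := by
  have key : ∀ y ∈ D, (f y < 0 ∨ f z < 0) → ∀ s : ℝ, 0 < s → s < 1 →
      f (z + s • (y - z)) < 0 := by
    intro y hy hor s hs0 hs1
    have h1 := hf.2 hz hy (show 0 ≤ 1 - s by linarith) hs0.le (by ring)
    have h2 : (1 - s) • z + s • y = z + s • (y - z) := by module
    simp only [h2, smul_eq_mul] at h1
    have h3 := hle y hy
    have h4 := hle z hz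
    rcases hor with h | h
    · nlinarith
    · nlinarith
  by_cases hxz : x₁ = z
  · obtain ⟨w, hw, hwz⟩ := hnt
    exact ⟨w, hw, hwz, key w hw (Or.inr (hxz ▸ hneg))⟩
  · exact ⟨x₁, hx₁, hxz, key x₁ hx₁ (Or.inl hneg)⟩
/-- Theorem 5.3: a line segment in the zero set at time `0` with an
extremal point inside `Ω` forces the solution to agree with the initial data there. -/
theorem stmt6 (n : ℕ) (p lam Lam : ℝ)
    (hp : 0 < p) (hlam : 0 < lam) (hll : lam ≤ Lam)
    (Ω : Set (E n)) (T : ℝ) (u : E n → ℝ → ℝ)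
    (hΩo : IsOpen Ω) (hΩc : Convex ℝ Ω) (hΩb : Bornology.IsBounded Ω)
    (hT : 0 < T)
    (hu : ViscositySolution lam Lam p Ω (-T) 0 u)
    (hnonneg : ∀ x ∈ Ω, 0 ≤ u x 0)
    (hseg : ∃ y z : E n, y ∈ {x ∈ Ω | u x 0 = 0} ∧ z ∈ {x ∈ Ω | u x 0 = 0} ∧ y ≠ z ∧
      segment ℝ y z ⊆ {x ∈ Ω | u x 0 = 0})
    (hext : ∃ x₀ ∈ Ω, x₀ ∈ closure {x ∈ Ω | u x 0 = 0} ∧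
      ExtremalPoint {x ∈ Ω | u x 0 = 0} x₀) :
    ∀ x ∈ Ω, u x 0 = 0 → u x (-T) = 0 := by

  by_contra! hcon
  obtain ⟨x₁, hx₁Ω, hx₁0, hx₁T⟩ := hcon
  obtain ⟨x₀, hx₀Ω, hx₀D, hx₀e⟩ := hext
  obtain ⟨w₁, w₂, hw₁, hw₂, hw, -⟩ := hseg
  set D : Set (E n) := {x ∈ Ω | u x 0 = 0} with hD
  have hreg := hu.1
  have hmem0 : (0 : ℝ) ∈ Icc (-T) 0 := ⟨by linarith, le_rfl⟩
  have hmemT : -T ∈ Icc (-T) 0 := ⟨le_rfl, by linarith⟩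
  have hcont : ContinuousOn (fun x => u x 0) Ω :=
    hreg.cont.comp (f := fun x => (x, (0 : ℝ))) (by fun_prop)
      (fun x hx => ⟨subset_closure hx, hmem0⟩)
  have hDΩ : ∀ x ∈ D, x ∈ Ω := fun x hx => hx.1
  have hD0 : ∀ x ∈ D, u x 0 = 0 := fun x hx => hx.2
  have hDc : Convex ℝ D := by
    intro x hx y hy α β hα hβ hαβ
    have hxy := hΩc (hDΩ x hx) (hDΩ y hy) hα hβ hαβ
    have h1 := (hreg.conv 0 hmem0).2 (subset_closure (hDΩ x hx)) (subset_closure (hDΩ y hy))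
      hα hβ hαβ
    simp only [hD0 x hx, hD0 y hy, smul_zero, add_zero] at h1
    exact ⟨hxy, le_antisymm h1 (hnonneg _ hxy)⟩
  obtain ⟨R, hR, hRΩ⟩ := Metric.nhds_basis_closedBall.mem_iff.1 (hΩo.mem_nhds hx₀Ω)
  set K := D ∩ closedBall x₀ R with hK
  have hKeq : K = {x | x ∈ closedBall x₀ R ∧ u x 0 = 0} := by
    ext x
    exact ⟨fun hx => ⟨hx.2, hx.1.2⟩, fun hx => ⟨⟨hRΩ hx.1, hx.2⟩, hx.1⟩⟩
  have hKc : IsCompact K := by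
    refine (isCompact_closedBall x₀ R).of_isClosed_subset ?_ inter_subset_right
    rw [hKeq]
    have h1 := (hcont.mono hRΩ).preimage_isClosed_of_isClosed isClosed_closedBall
      (isClosed_singleton (x := (0 : ℝ)))
    exact h1
  have hx₀D' : x₀ ∈ D := by
    refine ⟨hx₀Ω, ?_⟩
    have h1 : x₀ ∈ closure K := by
      rw [mem_closure_iff_nhds]
      intro t ht
      rw [mem_closure_iff_nhds] at hx₀D
      obtain ⟨y, hy1, hy2⟩ := hx₀D _ (Filter.inter_mem ht (closedBall_mem_nhds x₀ hR))
      exact ⟨y, hy1.1, hy2, hy1.2⟩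
    rw [hKc.isClosed.closure_eq] at h1
    exact h1.1.2
  have hx₀K : x₀ ∈ K.extremePoints ℝ := by
    rw [mem_extremePoints]
    refine ⟨⟨hx₀D', mem_closedBall_self hR.le⟩, ?_⟩
    rintro y hy z hz ⟨α, β, hα, hβ, hαβ, hxyz⟩
    have hyz : y = z := by
      by_contra hne
      exact hx₀e ⟨y, subset_closure hy.1, z, subset_closure hz.1, α, hα, by linarith, hne,
        by rw [← hxyz, ← hαβ, add_sub_cancel_left]⟩
    subst hyz
    rw [← add_smul, hαβ, one_smul] at hxyz
    exact ⟨hxyz, hxyz⟩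
  have hKv : Convex ℝ K := hDc.inter (convex_closedBall x₀ R)
  obtain ⟨z, hzK, hzd, e, he⟩ := exists_quadratic_support hKc hKv hx₀K (half_pos hR)
  have hzD : z ∈ D := hzK.1
  have hball : closedBall z (R / 2) ⊆ closedBall x₀ R :=
    closedBall_subset_closedBall' (by linarith)
  have hDT : ∀ x ∈ D, u x (-T) ≤ 0 := by
    intro x hx
    rw [← hD0 x hx]
    exact hreg.mono x (subset_closure hx.1) _ hmemT 0 hmem0 (by linarith)
  obtain ⟨y, hyD, hyz, hy⟩ := exists_direction_neg (f := fun x => u x (-T))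
    ((hreg.conv _ hmemT).subset (fun x hx => subset_closure (hDΩ x hx)) hDc) hDT
    (x₁ := x₁) ⟨hx₁Ω, hx₁0⟩ (lt_of_le_of_ne (hDT x₁ ⟨hx₁Ω, hx₁0⟩) hx₁T) hzD (by
      by_cases h1 : w₁ = z
      · exact ⟨w₂, hw₂, fun h2 => hw (h1.trans h2.symm)⟩
      · exact ⟨w₁, hw₁, h1⟩)
  set d := y - z with hd
  have hd0 : 0 < ‖d‖ := norm_pos_iff.2 (sub_ne_zero.2 hyz)
  set s := min 1 (min (R / 4 / ‖d‖) (R ^ 2 / 64 / (‖e‖ * ‖d‖ + 1))) with hs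
  have hs0 : 0 < s := by positivity
  have hs1 : s ≤ 1 := min_le_left _ _
  have hs2 : s * ‖d‖ ≤ R / 4 := by
    rw [← le_div_iff₀ hd0]
    exact (min_le_right _ _).trans (min_le_left _ _)
  have hs3 : s * (‖e‖ * ‖d‖ + 1) ≤ R ^ 2 / 64 := by
    rw [← le_div_iff₀ (by positivity)]
    exact (min_le_right _ _).trans (min_le_right _ _)
  have hnorm : ∀ α : ℝ, 0 ≤ α → ‖z + α • d - z‖ = α * ‖d‖ := by
    intro α hα
    rw [add_sub_cancel_left, norm_smul, Real.norm_of_nonneg hα]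
  have hy₁D : z + s • d ∈ D := hDc.add_smul_sub_mem hzD hyD ⟨hs0.le, hs1⟩
  have hy₁K : z + s • d ∈ K := by
    refine ⟨hy₁D, hball ?_⟩
    rw [mem_closedBall_iff_norm, hnorm s hs0.le]
    linarith
  have he₁ := he _ hy₁K
  rw [hnorm s hs0.le, add_sub_cancel_left, inner_smul_right] at he₁
  have hmid : z + (s / 2) • d + (z + (s / 2) • d - z) = z + s • d := by module
  have hcfg : TouchingConfig lam Lam p T Ω u z (z + (s / 2) • d) e (R / 2) (-(s * ⟪e, d⟫)) :=
    { isOpen := hΩo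
      convex := hΩc
      pos_p := hp
      pos_lam := hlam
      pos_Lam := hlam.trans_le hll
      pos_T := hT
      sol := hu
      nonneg := hnonneg
      pos_r := half_pos hR
      pos_b := by
        have : 0 < (s * ‖d‖) ^ 2 := by positivity
        linarith
      ball_subset := hball.trans hRΩ
      zero_x := hD0 z hzD
      mem_y := by rw [hmid]; exact hy₁D.1
      zero_y := by rw [hmid]; exact hy₁D.2
      inner_y := by
        rw [add_sub_cancel_left, inner_smul_right]
        ring
      norm_y := by
        rw [hnorm _ (by positivity)]
        linarith
      b_lt := by
        have h1 := neg_le_of_abs_le (abs_real_inner_le_norm e d)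
        have h2 := mul_le_mul_of_nonneg_left h1 hs0.le
        nlinarith [sq_pos_of_pos hR]
      supp := fun x hx hx0 => he x ⟨⟨hRΩ (hball hx), hx0⟩, hball hx⟩ }
  exact hcfg.not_neg (hy (s / 2) (by positivity) (by linarith))
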